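/- Let p and q be odd primes with √p < √q < √p + √2, and set n = pq. Then there exist finitely many matrices g_1, …, g_ℓ in SL(2,ℤ) such that: (i) the lower-left entry of g_i equals 2n if i ≤ q − p and equals n if i > q − p; (ii) |tr g_i| ≤ c_i − 2 and ‖g_i‖_F < 2c_i − 1, where c_i is the lower-left entry of g_i; and (iii) the image of Γ₀(n) in PSL(2,ℤ) is the free product of the cyclic subgroups generated by the images of g_1, …, g_ℓ together with the infinite cyclic subgroup generated by T, i.e. the natural homomorphism from the abstract free product ⟨g_1⟩ ∗ ⋯ ∗ ⟨g_ℓ⟩ ∗ ⟨T⟩ of these cyclic groups to PSL(2,ℤ) is injective with image Γ₀(n). -/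

import Mathlib

open Matrix

/-- `SL(2, ℤ)`. -/
abbrev SL2Z := Matrix.SpecialLinearGroup (Fin 2) ℤ

/-- `PSL(2, ℤ)`, the quotient of `SL(2, ℤ)` by its center. -/
abbrev PSL2Z := SL2Z ⧸ Subgroup.center SL2Z

/-- The natural projection `SL(2, ℤ) → PSL(2, ℤ)`. -/
def projPSL : SL2Z →* PSL2Z := QuotientGroup.mk' (Subgroup.center SL2Z)

set_option linter.unusedSimpArgs false
set_option linter.unusedVariables false
set_option linter.unusedSectionVars false
set_option linter.style.haveILetI false


/-- Abstract elimination state for a trivalent graph with dart set `D`. -/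
structure ElimGood {D : Type} (σ ρ : D → D) (A : Set D) (Rt : D → Prop) (N P : Set D) : Prop where
  subA : N ⊆ A
  rho_mem : ∀ x ∈ N, ρ x ∈ N
  fix : ∀ x ∈ N, ρ x = x → σ x ∈ N ∨ σ x ∉ A
  parent : ∀ x ∈ P, x ∈ N ∧ (σ x ∈ N ∨ (σ x ∉ A ∧ Rt x))
  ext : ∀ (F : Type) [Group F] (g : D → F), (∀ x, g (σ x) * g x = 1) →
    (∀ x ∈ A, ρ x = x → g x * g x * g x = 1) →
    ∃ f : D → F, (∀ x, f (σ x) * f x = 1) ∧ (∀ x ∈ N, f x * f (ρ x) * f (ρ (ρ x)) = 1) ∧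
      ∀ x, x ∉ P → σ x ∉ P → f x = g x
  gen : ∀ (F : Type) [Group F] (f : D → F), (∀ x, f (σ x) * f x = 1) →
    (∀ x ∈ N, f x * f (ρ x) * f (ρ (ρ x)) = 1) → ∀ (K : Subgroup F),
    (∀ x, x ∉ P → σ x ∉ P → f x ∈ K) → ∀ x, f x ∈ K

section Elim

variable {D : Type} {σ ρ : D → D} {A : Set D} {Rt : D → Prop}

theorem elimGood_empty : ElimGood σ ρ A Rt ∅ ∅ where
  subA := by simp
  rho_mem := by simp
  fix := by simp
  parent := by simp
  ext := fun F _ g hg _ => ⟨g, hg, by simp, by simp⟩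
  gen := fun F _ f _ _ K hK x => hK x (by simp) (by simp)

theorem elimGood_step_fix (hσ : ∀ x, σ (σ x) = x) {N P : Set D}
    (h : ElimGood σ ρ A Rt N P) {x : D} (hxA : x ∈ A) (hxN : x ∉ N) (hfix : ρ x = x)
    (hx : σ x ∈ N ∨ σ x ∉ A) : ElimGood σ ρ A Rt (insert x N) P where
  subA := Set.insert_subset hxA h.subA
  rho_mem := by
    rintro y (rfl | hy)
    · rw [hfix]; exact Set.mem_insert _ _
    · exact Set.mem_insert_of_mem _ (h.rho_mem y hy)
  fix := by
    rintro y (rfl | hy) hf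
    · exact hx.imp (Set.mem_insert_of_mem _) id
    · exact (h.fix y hy hf).imp (Set.mem_insert_of_mem _) id
  parent := fun y hy => ⟨Set.mem_insert_of_mem _ (h.parent y hy).1,
    (h.parent y hy).2.imp (Set.mem_insert_of_mem _) id⟩
  ext := by
    intro F _ g hg hg3
    obtain ⟨f, h1, h2, h3⟩ := h.ext F g hg hg3
    refine ⟨f, h1, ?_, h3⟩
    rintro y (rfl | hy)
    · have hP : y ∉ P := fun hy => hxN (h.parent y hy).1
      have hP' : σ y ∉ P := by
        intro hy
        rcases (h.parent _ hy).2 with h4 | h4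
        · rw [hσ] at h4; exact hxN h4
        · rw [hσ] at h4; exact h4.1 hxA
      rw [hfix, hfix, h3 y hP hP']
      exact hg3 y hxA hfix
    · exact h2 y hy
  gen := fun F _ f h1 h2 K hK => h.gen F f h1 (fun y hy => h2 y (Set.mem_insert_of_mem _ hy)) K hK

theorem elimGood_step (hσ : ∀ x, σ (σ x) = x) (hρA : ∀ x ∈ A, ρ x ∈ A)
    (hρ : ∀ x ∈ A, ρ (ρ (ρ x)) = x) {N P : Set D}
    (h : ElimGood σ ρ A Rt N P) {x : D} (hxA : x ∈ A) (hxN : x ∉ N) (hnf : ρ x ≠ x)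
    (hx : σ x ∈ N ∨ (σ x ∉ A ∧ Rt x)) :
    ElimGood σ ρ A Rt (N ∪ {x, ρ x, ρ (ρ x)}) (insert x P) := by
  classical
  have hrN : ρ x ∉ N := fun hh => hxN (by
    have := h.rho_mem _ (h.rho_mem _ hh); rwa [hρ x hxA] at this)
  have hrrN : ρ (ρ x) ∉ N := fun hh => hxN (by
    have := h.rho_mem _ hh; rwa [hρ x hxA] at this)
  have hrA := hρA x hxA
  have hrrA := hρA _ hrA
  have key : ∀ y ∈ A, y ∉ N → y ∉ P ∧ σ y ∉ P := by
    intro y hyA hyN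
    refine ⟨fun hy => hyN (h.parent y hy).1, fun hy => ?_⟩
    rcases (h.parent _ hy).2 with h4 | h4
    · rw [hσ] at h4; exact hyN h4
    · rw [hσ] at h4; exact h4.1 hyA
  have hnes : ∀ y ∈ A, y ∉ N → y ≠ σ x := by
    rintro y hyA hyN rfl
    rcases hx with h1 | h1
    · exact hyN h1
    · exact h1.1 hyA
  have hr1 : ρ (ρ x) ≠ x := by
    intro h5
    apply hnf
    have := hρ x hxA
    rw [h5] at this
    exact this
  have hsne : σ x ≠ x := (hnes x hxA hxN).symm
  refine ⟨?_, ?_, ?_, ?_, ?_, ?_⟩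
  · rintro y (hy | rfl | rfl | rfl)
    · exact h.subA hy
    all_goals assumption
  · rintro y (hy | rfl | rfl | rfl)
    · exact Or.inl (h.rho_mem y hy)
    · right; simp
    · right; simp
    · right; rw [hρ _ hxA]; simp
  · rintro y (hy | rfl | rfl | rfl) hf
    · exact (h.fix y hy hf).imp Or.inl id
    · exact absurd hf hnf
    · exfalso
      have := hρ x hxA
      rw [hf, hf] at this
      exact hnf this
    · exfalso
      rw [hρ _ hxA] at hf
      exact hr1 hf.symm
  · rintro y (rfl | hy)
    · exact ⟨Or.inr (by simp), hx.imp Or.inl id⟩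
    · exact ⟨Or.inl (h.parent y hy).1, (h.parent y hy).2.imp Or.inl id⟩
  · intro F _ g hg hg3
    set c : F := g (ρ x) * g (ρ (ρ x)) with hc
    let g' : D → F := fun y => if y = x then c⁻¹ else if y = σ x then c else g y
    have hg'x : g' x = c⁻¹ := by simp [g']
    have hg's : g' (σ x) = c := by simp [g', hsne]
    have hg'o : ∀ y, y ≠ x → y ≠ σ x → g' y = g y := by
      intro y h1 h2; simp [g', h1, h2]
    obtain ⟨f, h1, h2, h3⟩ := h.ext F g' (by
      intro y
      by_cases hy : y = x
      · subst hy; rw [hg'x, hg's]; simp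
      by_cases hy2 : y = σ x
      · subst hy2; rw [hσ, hg'x, hg's]; simp
      rw [hg'o y hy hy2, hg'o (σ y), hg y]
      · intro h5; apply hy2; rw [← h5, hσ]
      · intro h5; apply hy; rw [← hσ y, h5, hσ]) (by
      intro y hyA hyf
      have hy : y ≠ x := by rintro rfl; exact hnf hyf
      have hy2 : y ≠ σ x := by
        rintro rfl
        rcases hx with h4 | h4
        · rcases h.fix _ h4 hyf with h5 | h5
          · rw [hσ] at h5; exact hxN h5
          · rw [hσ] at h5; exact h5 hxA
        · exact h4.1 hyA
      rw [hg'o y hy hy2]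
      exact hg3 y hyA hyf)
    have e0 : f x = c⁻¹ := by
      rw [h3 x (key x hxA hxN).1 (key x hxA hxN).2, hg'x]
    have e1 : f (ρ x) = g (ρ x) := by
      rw [h3 _ (key _ hrA hrN).1 (key _ hrA hrN).2, hg'o _ hnf (hnes _ hrA hrN)]
    have e2 : f (ρ (ρ x)) = g (ρ (ρ x)) := by
      rw [h3 _ (key _ hrrA hrrN).1 (key _ hrrA hrrN).2, hg'o _ hr1 (hnes _ hrrA hrrN)]
    refine ⟨f, h1, ?_, ?_⟩
    · rintro y (hy | rfl | rfl | rfl)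
      · exact h2 y hy
      · rw [e0, e1, e2, hc]; group
      · rw [hρ _ hxA, e0, e1, e2, hc]; group
      · rw [hρ _ hxA, e0, e1, e2, hc]; group
    · intro y hy hy'
      simp only [Set.mem_insert_iff, not_or] at hy hy'
      rw [h3 y hy.2 hy'.2, hg'o y hy.1]
      rintro rfl
      exact hy'.1 (hσ x)
  · intro F _ f h1 h2 K hK
    apply h.gen F f h1 (fun y hy => h2 y (Or.inl hy)) K
    have hin : ∀ y ∈ A, y ∉ N → y ≠ x → f y ∈ K := by
      intro y hyA hyN hyx
      refine hK y ?_ ?_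
      · rintro (h5 | h5)
        · exact hyx h5
        · exact (key y hyA hyN).1 h5
      · rintro (h5 | h5)
        · exact hnes y hyA hyN (by rw [← h5, hσ])
        · exact (key y hyA hyN).2 h5
    have hfx : f x ∈ K := by
      have h5 := h2 x (Or.inr (by simp))
      rw [mul_assoc] at h5
      rw [eq_inv_of_mul_eq_one_left h5]
      exact K.inv_mem (K.mul_mem (hin _ hrA hrN hnf) (hin _ hrrA hrrN hr1))
    intro y hy hy'
    by_cases hyx : y = x
    · rw [hyx]; exact hfx
    by_cases hyx' : σ y = x
    · have h5 := h1 y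
      rw [hyx'] at h5
      rw [eq_inv_of_mul_eq_one_right h5]
      exact K.inv_mem hfx
    · refine hK y ?_ ?_
      · rintro (h5 | h5)
        · exact hyx h5
        · exact hy h5
      · rintro (h5 | h5)
        · exact hyx' h5
        · exact hy' h5

theorem elimGood_max [Finite D] (hσ : ∀ x, σ (σ x) = x) (hρA : ∀ x ∈ A, ρ x ∈ A)
    (hρ : ∀ x ∈ A, ρ (ρ (ρ x)) = x) :
    ∃ N P, ElimGood σ ρ A Rt N P ∧ ∀ x ∈ A,
      (σ x ∈ N ∨ (σ x ∉ A ∧ Rt x) ∨ (ρ x = x ∧ σ x ∉ A)) → x ∈ N := by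
  have hfin : {N : Set D | ∃ P, ElimGood σ ρ A Rt N P}.Finite := Set.toFinite _
  obtain ⟨N, hN⟩ := hfin.exists_maximal ⟨∅, ∅, elimGood_empty⟩
  obtain ⟨P, hP⟩ := hN.prop
  refine ⟨N, P, hP, fun x hxA hx => ?_⟩
  by_contra hxN
  by_cases hf : ρ x = x
  · have h1 := elimGood_step_fix hσ hP hxA hxN hf (by tauto)
    have h2 := hN.le_of_ge (y := insert x N) ⟨P, h1⟩ (Set.subset_insert _ _)
    exact hxN (h2 (Set.mem_insert _ _))
  · have h1 := elimGood_step hσ hρA hρ hP hxA hxN hf (by tauto)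
    have h2 := hN.le_of_ge (y := N ∪ {x, ρ x, ρ (ρ x)}) ⟨_, h1⟩ Set.subset_union_left
    exact hxN (h2 (Or.inr (by simp)))

end Elim
/-- Numerical certificate: rooting differences `Al`, and pairs `J`. -/
structure NumCert (p q m : ℕ) (Al J : Finset ℕ) : Prop where
  sub : ∀ t ∈ J, 2 ≤ t ∧ t ≤ q - 2
  card : J.card = 2 * m - 1
  avoid : ∀ t ∈ J, ∀ d ∈ Al, ¬ q ∣ t * d + 1 ∧ ¬ q ∣ (t + 1) * d + 1
  three : ∀ t ∈ J, p = 3 → ¬ q ∣ 3 * t ^ 2 + 3 * t + 1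
  cover : ∀ d, 1 ≤ d → d ≤ 2 * m - 1 → d ∈ Al ∨
    (∃ a α β, 1 ≤ a ∧ a ≤ p - 2 ∧ 1 ≤ α ∧ α ≤ p - 2 ∧ 1 ≤ β ∧ β ≤ q - 2 ∧ p ∣ α * (a + 1) + 1 ∧
      q ∣ β * (a + d + 1) + 1 ∧ (β ≤ α ∨ α + 2 * m ≤ β)) ∨
    (p = 3 ∧ q ∣ (d + 1) ^ 2 + (d + 1) + 1)

/-- Decidable form of the certificate. -/
def certCheck (p q m : ℕ) (Al J : Finset ℕ) (W : List (ℕ × ℕ × ℕ × ℕ)) : Prop :=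
  (∀ t ∈ J, 2 ≤ t ∧ t ≤ q - 2) ∧ J.card = 2 * m - 1 ∧
  (∀ t ∈ J, ∀ d ∈ Al, ¬ q ∣ t * d + 1 ∧ ¬ q ∣ (t + 1) * d + 1) ∧
  (∀ t ∈ J, p = 3 → ¬ q ∣ 3 * t ^ 2 + 3 * t + 1) ∧
  ∀ d < 2 * m, d = 0 ∨ d ∈ Al ∨
    (∃ w ∈ W, w.1 = d ∧ (1 ≤ w.2.1 ∧ w.2.1 ≤ p - 2 ∧ 1 ≤ w.2.2.1 ∧ w.2.2.1 ≤ p - 2 ∧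
      1 ≤ w.2.2.2 ∧ w.2.2.2 ≤ q - 2 ∧ p ∣ w.2.2.1 * (w.2.1 + 1) + 1 ∧
      q ∣ w.2.2.2 * (w.2.1 + d + 1) + 1 ∧ (w.2.2.2 ≤ w.2.2.1 ∨ w.2.2.1 + 2 * m ≤ w.2.2.2))) ∨
    (p = 3 ∧ q ∣ (d + 1) ^ 2 + (d + 1) + 1)

instance (p q m : ℕ) (Al J : Finset ℕ) (W : List (ℕ × ℕ × ℕ × ℕ)) :
    Decidable (certCheck p q m Al J W) := by
  unfold certCheck; infer_instance

theorem cert_of_check {p q m : ℕ} {Al J : Finset ℕ} (W : List (ℕ × ℕ × ℕ × ℕ))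
    (h : certCheck p q m Al J W) : ∃ Al J, NumCert p q m Al J := by
  obtain ⟨h1, h2, h3, h4, h5⟩ := h
  refine ⟨Al, J, h1, h2, h3, h4, ?_⟩
  intro d hd1 hd2
  rcases h5 d (by omega) with h | h | ⟨w, -, h6, h7⟩ | h
  · omega
  · exact Or.inl h
  · exact Or.inr (Or.inl ⟨_, _, _, h7⟩)
  · exact Or.inr (Or.inr h)

theorem cert_large {p q m : ℕ} (hq : q.Prime) (hm : 1 ≤ m) (hqp : q = p + 2 * m)
    (hp : 4 * m ≤ p) : ∃ Al J, NumCert p q m Al J := by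
  haveI : Fact q.Prime := ⟨hq⟩
  let Al := Finset.Icc 1 (2 * m - 1)
  let r : ℕ → ℕ := fun d => (-((d : ZMod q))⁻¹).val
  let B := Finset.Icc 2 (q - 2) \ (Al.image r ∪ Al.image (fun d => r d - 1))
  have hkey : ∀ t d : ℕ, t < q → q ∣ t * d + 1 → t = r d := by
    intro t d ht h
    have h1 : ((t * d + 1 : ℕ) : ZMod q) = 0 := (ZMod.natCast_eq_zero_iff _ _).2 h
    push_cast at h1
    have hd : (d : ZMod q) ≠ 0 := by
      intro h0; rw [h0] at h1; simp at h1
    have h2 : (t : ZMod q) = -((d : ZMod q))⁻¹ := by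
      field_simp; linear_combination h1
    change t = (-((d : ZMod q))⁻¹).val
    rw [← h2, ZMod.val_natCast_of_lt ht]
  have hc : 2 * m - 1 ≤ B.card := by
    have h1 := Finset.le_card_sdiff (Al.image r ∪ Al.image (fun d => r d - 1))
      (Finset.Icc 2 (q - 2))
    have h2 := Finset.card_union_le (Al.image r) (Al.image (fun d => r d - 1))
    have h3 := Finset.card_image_le (s := Al) (f := r)
    have h4 := Finset.card_image_le (s := Al) (f := fun d => r d - 1)
    have h5 : Al.card = 2 * m - 1 := by simp [Al]
    have h6 : (Finset.Icc 2 (q - 2)).card = q - 2 + 1 - 2 := by simp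
    change _ ≤ B.card at h1
    omega
  obtain ⟨J, hJB, hJ⟩ := Finset.exists_subset_card_eq hc
  refine ⟨Al, J, ?_, hJ, ?_, ?_, ?_⟩
  · intro t ht
    have := hJB ht
    simp only [B, Finset.mem_sdiff, Finset.mem_Icc] at this
    exact this.1
  · intro t ht d hd
    have h1 := hJB ht
    simp only [B, Finset.mem_sdiff, Finset.mem_Icc, Finset.mem_union, Finset.mem_image, not_or,
      not_exists, not_and] at h1
    constructor
    · intro h
      exact h1.2.1 d hd (hkey t d (by omega) h).symm
    · intro h
      have := hkey (t + 1) d (by omega) h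
      exact h1.2.2 d hd (by omega)
  · intro t _ h3; omega
  · intro d h1 h2
    left; simp [Al]; omega

theorem cert_exists {p q m : ℕ} (hpp : p.Prime) (hq : q.Prime) (hp2 : Odd p) (hm : 1 ≤ m)
    (hqp : q = p + 2 * m) (hmp : (m - 1) ^ 2 < 2 * p) : ∃ Al J, NumCert p q m Al J := by
  by_cases hp : 4 * m ≤ p
  · exact cert_large hq hm hqp hp
  push Not at hp
  have hm9 : m ≤ 9 := by
    by_contra h
    push Not at h
    obtain ⟨k, rfl⟩ := Nat.exists_eq_add_of_lt h
    have : 9 + k + 1 - 1 = 9 + k := by omega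
    rw [this] at hmp
    nlinarith
  have hp36 : p < 36 := by omega
  clear hp2
  have hlist : (p, m) ∈ [(3, 1), (3, 2), (5, 3), (5, 4), (7, 2), (7, 3), (11, 3), (11, 4), (13, 5), (17, 6), (19, 5), (19, 6), (23, 7), (31, 8)] := by
    subst hqp
    interval_cases p <;> first
      | (exfalso; revert hpp; norm_num; done)
      | skip
    all_goals
      interval_cases m <;> first
        | omega
        | (exfalso; revert hq; norm_num; done)
        | decide
  simp only [List.mem_cons, List.not_mem_nil, or_false, Prod.mk.injEq] at hlist
  subst hqp
  rcases hlist with ⟨rfl, rfl⟩ | ⟨rfl, rfl⟩ | ⟨rfl, rfl⟩ | ⟨rfl, rfl⟩ | ⟨rfl, rfl⟩ | ⟨rfl, rfl⟩ | ⟨rfl, rfl⟩ | ⟨rfl, rfl⟩ | ⟨rfl, rfl⟩ | ⟨rfl, rfl⟩ | ⟨rfl, rfl⟩ | ⟨rfl, rfl⟩ | ⟨rfl, rfl⟩ | ⟨rfl, rfl⟩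
  · exact cert_of_check (Al := {1}) (J := {2})
      [] (by decide +kernel)
  · exact cert_of_check (Al := ∅) (J := {2, 3, 4})
      [(2, 1, 1, 5)] (by decide +kernel)
  · exact cert_of_check (Al := {1, 5}) (J := {3, 4, 5, 6, 7})
      [(2, 1, 2, 8), (3, 1, 2, 2), (4, 1, 2, 9)] (by decide +kernel)
  · exact cert_of_check (Al := {1, 2}) (J := {2, 3, 4, 7, 8, 9, 10})
      [(3, 2, 3, 2), (4, 1, 2, 2), (5, 1, 2, 11), (6, 3, 1, 9), (7, 1, 2, 10)] (by decide +kernel)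
  · exact cert_of_check (Al := {1, 2, 3}) (J := {2, 3, 8})
      [] (by decide +kernel)
  · exact cert_of_check (Al := ∅) (J := {2, 3, 4, 5, 6})
      [(1, 3, 5, 5), (2, 1, 3, 3), (3, 2, 2, 2), (4, 1, 3, 2), (5, 1, 3, 11)] (by decide +kernel)
  · exact cert_of_check (Al := {1, 2, 3, 4, 5}) (J := {2, 5, 6, 12, 13})
      [] (by decide +kernel)
  · exact cert_of_check (Al := {4, 5}) (J := {2, 3, 4, 5, 6, 7, 8})
      [(1, 5, 9, 8), (2, 1, 5, 14), (3, 1, 5, 15), (6, 2, 7, 2), (7, 1, 5, 2)] (by decide +kernel)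
  · exact cert_of_check (Al := {1, 3, 5}) (J := {2, 3, 4, 5, 6, 7, 10, 11, 12})
      [(2, 1, 6, 17), (4, 1, 6, 19), (6, 1, 6, 20), (7, 1, 6, 5), (8, 1, 6, 16), (9, 1, 6, 2)] (by decide +kernel)
  · exact cert_of_check (Al := {7, 10}) (J := {2, 5, 6, 7, 8, 9, 10, 11, 12, 13, 14})
      [(1, 2, 11, 7), (2, 1, 8, 7), (3, 1, 8, 23), (4, 1, 8, 24), (5, 1, 8, 4), (6, 3, 4, 26), (8, 1, 8, 26), (9, 1, 8, 21), (11, 1, 8, 20)] (by decide +kernel)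
  · exact cert_of_check (Al := {1, 2, 3, 4, 5, 6, 7, 8, 9}) (J := {2, 5, 8, 9, 10, 11, 12, 20, 21})
      [] (by decide +kernel)
  · exact cert_of_check (Al := {1, 2, 3, 4, 5, 6, 7, 8, 9, 10, 11}) (J := {7, 8, 11, 12, 16, 17, 18, 19, 20, 25, 28})
      [] (by decide +kernel)
  · exact cert_of_check (Al := {1, 2, 3, 4, 5, 6, 7, 8, 9, 10, 11, 12, 13}) (J := {7, 13, 14, 15, 19, 24, 25, 26, 27, 28, 29, 30, 31})
      [] (by decide +kernel)
  · exact cert_of_check (Al := {1, 2, 3, 4, 5, 6, 7, 8, 9, 10, 11, 12, 13, 14, 15}) (J := {2, 3, 4, 5, 6, 7, 8, 11, 12, 15, 21, 29, 32, 33, 36})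
      [] (by decide +kernel)
theorem e00 (A B : SL2Z) : (A * B) 0 0 = A 0 0 * B 0 0 + A 0 1 * B 1 0 := by
  simp [Matrix.SpecialLinearGroup.coe_mul, Matrix.mul_apply, Fin.sum_univ_two]
theorem e01 (A B : SL2Z) : (A * B) 0 1 = A 0 0 * B 0 1 + A 0 1 * B 1 1 := by
  simp [Matrix.SpecialLinearGroup.coe_mul, Matrix.mul_apply, Fin.sum_univ_two]
theorem e10 (A B : SL2Z) : (A * B) 1 0 = A 1 0 * B 0 0 + A 1 1 * B 1 0 := by
  simp [Matrix.SpecialLinearGroup.coe_mul, Matrix.mul_apply, Fin.sum_univ_two]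
theorem e11 (A B : SL2Z) : (A * B) 1 1 = A 1 0 * B 0 1 + A 1 1 * B 1 1 := by
  simp [Matrix.SpecialLinearGroup.coe_mul, Matrix.mul_apply, Fin.sum_univ_two]
theorem neg_e (A : SL2Z) (i j : Fin 2) : (-A) i j = - A i j := by
  simp
theorem sl_ext {A B : SL2Z} (h1 : A 0 0 = B 0 0) (h2 : A 0 1 = B 0 1) (h3 : A 1 0 = B 1 0)
    (h4 : A 1 1 = B 1 1) : A = B := by
  ext i j; fin_cases i <;> fin_cases j <;> assumption
theorem S00 : ModularGroup.S 0 0 = 0 := rfl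
theorem S01 : ModularGroup.S 0 1 = -1 := rfl
theorem S10 : ModularGroup.S 1 0 = 1 := rfl
theorem S11 : ModularGroup.S 1 1 = 0 := rfl
theorem T00 (j : ℤ) : (ModularGroup.T ^ j) 0 0 = 1 := by rw [ModularGroup.coe_T_zpow]; rfl
theorem T01 (j : ℤ) : (ModularGroup.T ^ j) 0 1 = j := by rw [ModularGroup.coe_T_zpow]; rfl
theorem T10 (j : ℤ) : (ModularGroup.T ^ j) 1 0 = 0 := by rw [ModularGroup.coe_T_zpow]; rfl
theorem T11 (j : ℤ) : (ModularGroup.T ^ j) 1 1 = 1 := by rw [ModularGroup.coe_T_zpow]; rfl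
theorem T00' : ModularGroup.T 0 0 = 1 := rfl
theorem T01' : ModularGroup.T 0 1 = 1 := rfl
theorem T10' : ModularGroup.T 1 0 = 0 := rfl
theorem T11' : ModularGroup.T 1 1 = 1 := rfl
theorem sl_det (A : SL2Z) : A 0 0 * A 1 1 - A 0 1 * A 1 0 = 1 := by
  have := A.2
  rwa [Matrix.det_fin_two] at this

/-- The homomorphism from a finite cyclic group given by an element with `g ^ k = 1`. -/
def zhom {G : Type} [Group G] (k : ℕ) (g : G) (h : g ^ k = 1) : Multiplicative (ZMod k) →* G :=
  AddMonoidHom.toMultiplicativeLeft (ZMod.lift k ⟨zmultiplesHom (Additive G) (Additive.ofMul g), by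
    simp only [zmultiplesHom_apply, natCast_zsmul]; exact h⟩)

theorem zhom_apply {G : Type} [Group G] (k : ℕ) (g : G) (h : g ^ k = 1) (j : ℤ) :
    zhom k g h (Multiplicative.ofAdd (j : ZMod k)) = g ^ j := by
  simp [zhom]

theorem zhom_one {G : Type} [Group G] (k : ℕ) (g : G) (h : g ^ k = 1) :
    zhom k g h (Multiplicative.ofAdd 1) = g := by
  have := zhom_apply k g h 1
  simpa using this

theorem proj_eq_iff (A B : SL2Z) : projPSL A = projPSL B ↔ (B = A ∨ B = -A) := by
  have h1 : projPSL A = projPSL B ↔ A⁻¹ * B ∈ Subgroup.center SL2Z := by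
    simp only [projPSL, QuotientGroup.coe_mk', QuotientGroup.eq]
  rw [h1, Matrix.SpecialLinearGroup.mem_center_iff]
  constructor
  · rintro ⟨r, hr, hr2⟩
    simp only [Fintype.card_fin] at hr
    rcases (sq_eq_one_iff.mp hr : r = 1 ∨ r = -1) with rfl | rfl
    · left
      have : A⁻¹ * B = 1 := by
        apply Subtype.ext
        rw [← hr2]; simp
      rw [inv_mul_eq_one] at this; exact this.symm
    · right
      have : A⁻¹ * B = -1 := by
        apply Subtype.ext
        rw [← hr2]; ext i j; fin_cases i <;> fin_cases j <;> simp
      rw [inv_mul_eq_iff_eq_mul] at this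
      rw [this]; simp
  · rintro (rfl | rfl)
    · exact ⟨1, by simp, by simp⟩
    · refine ⟨-1, by simp, ?_⟩
      ext i j; fin_cases i <;> fin_cases j <;> simp

theorem proj_neg (A : SL2Z) : projPSL (-A) = projPSL A := (proj_eq_iff _ _).2 (Or.inr (by simp))

theorem proj_surj : Function.Surjective projPSL := QuotientGroup.mk'_surjective _

open ModularGroup in
theorem psl_SS : projPSL S ^ 2 = 1 := by
  rw [← map_pow, ← map_one projPSL, proj_eq_iff]
  right
  simp only [pow_succ, pow_zero, one_mul]
  apply sl_ext <;> rw [neg_e] <;>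
    simp [e00, e01, e10, e11, S00, S01, S10, S11, T00', T01', T10', T11', -Matrix.SpecialLinearGroup.coe_mul]

open ModularGroup in
theorem psl_UU : projPSL (S * T) ^ 3 = 1 := by
  rw [← map_pow, ← map_one projPSL, proj_eq_iff]
  right
  simp only [pow_succ, pow_zero, one_mul]
  apply sl_ext <;> rw [neg_e] <;>
    simp [e00, e01, e10, e11, S00, S01, S10, S11, T00', T01', T10', T11', -Matrix.SpecialLinearGroup.coe_mul]

/-- sign set for ping pong -/
def signSet (i : Bool) : Set PSL2Z :=
  {x | ∃ A : SL2Z, projPSL A = x ∧ 0 < (if i then 1 else -1) * (A 0 0 * A 1 0)}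

open ModularGroup in
/-- Free factors of the modular group. -/
def pslFactor (i : Bool) : Multiplicative (ZMod (cond i 2 3)) →* PSL2Z :=
  match i with
  | true => zhom 2 (projPSL S) psl_SS
  | false => zhom 3 (projPSL (S * T)) psl_UU

open ModularGroup in
theorem psl_lift_inj : Function.Injective (Monoid.CoprodI.lift pslFactor) := by
  apply Monoid.CoprodI.lift_injective_of_ping_pong pslFactor _ signSet
  · rintro (_ | _)
    · exact ⟨_, T⁻¹ * S * T⁻¹ , rfl, by decide⟩
    · exact ⟨_, T * S * T⁻¹, rfl, by decide⟩
  · have hd : Disjoint (signSet true) (signSet false) := by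
      rw [Set.disjoint_left]
      rintro _ ⟨A, rfl, hA⟩ ⟨B, hB, hB2⟩
      rcases (proj_eq_iff _ _).1 hB with rfl | rfl
      · simp at hA hB2; linarith
      · simp only [neg_e] at hA; simp at hA hB2; linarith
    rintro (_ | _) (_ | _) hij
    · exact absurd rfl hij
    · exact hd.symm
    · exact hd
    · exact absurd rfl hij
  · rintro (_ | _) (_ | _) hij
    · exact absurd rfl hij
    · intro h hh
      rintro _ ⟨_, ⟨A, rfl, hA⟩, rfl⟩
      have h2 : h = Multiplicative.ofAdd ((1 : ℤ) : ZMod 3) ∨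
          h = Multiplicative.ofAdd ((2 : ℤ) : ZMod 3) := by
        revert hh; revert h; change ∀ h : ZMod 3, h ≠ 0 → h = 1 ∨ h = 2; decide
      simp only [if_true, one_mul] at hA
      rcases h2 with rfl | rfl
      · refine ⟨(S * T) * A, ?_, ?_⟩
        · rw [map_mul]
          change _ = zhom 3 (projPSL (S * T)) psl_UU _ * _
          rw [zhom_apply, zpow_one]
        · simp only [e00, e01, e10, e11, S00, S01, S10, S11, T00', T01', T10', T11']
          simp
          nlinarith [mul_self_nonneg (A 1 0)]
      · refine ⟨(S * T) ^ (2 : ℤ) * A, ?_, ?_⟩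
        · rw [map_mul, map_zpow]
          change _ = zhom 3 (projPSL (S * T)) psl_UU _ * _
          rw [zhom_apply]
        · rw [zpow_two]
          simp only [e00, e01, e10, e11, S00, S01, S10, S11, T00', T01', T10', T11']
          simp
          nlinarith [mul_self_nonneg (A 0 0)]
    · intro h hh
      rintro _ ⟨_, ⟨A, rfl, hA⟩, rfl⟩
      have h2 : h = Multiplicative.ofAdd ((1 : ℤ) : ZMod 2) := by
        revert hh; revert h; change ∀ h : ZMod 2, h ≠ 0 → h = 1; decide
      subst h2
      refine ⟨S * A, ?_, ?_⟩
      · rw [map_mul]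
        change _ = zhom 2 (projPSL S) psl_SS _ * _
        rw [zhom_apply, zpow_one]
      · simp only [e00, e01, e10, e11, S00, S01, S10, S11, T00', T01', T10', T11']
        simp at hA ⊢
        linarith
    · exact absurd rfl hij
  · right
    refine ⟨false, ?_⟩
    change 3 ≤ Cardinal.mk (ZMod 3)
    rw [Cardinal.mk_fintype]; simp

theorem psl_presentation {G : Type} [Group G] (s u : G) (hs : s ^ 2 = 1) (hu : u ^ 3 = 1) :
    ∃ Θ : SL2Z →* G, Θ ModularGroup.S = s ∧ Θ (ModularGroup.S * ModularGroup.T) = u ∧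
      Θ (-1) = 1 := by
  have hsurj : Function.Surjective (Monoid.CoprodI.lift pslFactor) := by
    rw [← MonoidHom.range_eq_top]
    have hS : projPSL ModularGroup.S ∈ (Monoid.CoprodI.lift pslFactor).range :=
      ⟨Monoid.CoprodI.of (i := true) (Multiplicative.ofAdd 1), by
        rw [Monoid.CoprodI.lift_of]; exact zhom_one 2 (projPSL ModularGroup.S) psl_SS⟩
    have hU : projPSL (ModularGroup.S * ModularGroup.T) ∈ (Monoid.CoprodI.lift pslFactor).range :=
      ⟨Monoid.CoprodI.of (i := false) (Multiplicative.ofAdd 1), by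
        rw [Monoid.CoprodI.lift_of]
        exact zhom_one 3 (projPSL (ModularGroup.S * ModularGroup.T)) psl_UU⟩
    have hT : projPSL ModularGroup.T ∈ (Monoid.CoprodI.lift pslFactor).range := by
      have := mul_mem (inv_mem hS) hU
      rwa [← map_inv, ← map_mul, inv_mul_cancel_left] at this
    rw [eq_top_iff]
    rintro x -
    obtain ⟨A, rfl⟩ := proj_surj x
    have hA : A ∈ Subgroup.closure {ModularGroup.S, ModularGroup.T} := by
      rw [SpecialLinearGroup.SL2Z_generators]; trivial
    have : Subgroup.closure {ModularGroup.S, ModularGroup.T} ≤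
        ((Monoid.CoprodI.lift pslFactor).range).comap projPSL := by
      rw [Subgroup.closure_le]
      rintro y (rfl | rfl)
      · exact hS
      · exact hT
    exact this hA
  let e := MulEquiv.ofBijective (Monoid.CoprodI.lift pslFactor) ⟨psl_lift_inj, hsurj⟩
  let L : ∀ i : Bool, Multiplicative (ZMod (cond i 2 3)) →* G := fun i =>
    match i with
    | true => zhom 2 s hs
    | false => zhom 3 u hu
  have key : ∀ x, (Monoid.CoprodI.lift L) (e.symm (Monoid.CoprodI.lift pslFactor x)) =
      Monoid.CoprodI.lift L x := by
    intro x
    congr 1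
    exact e.symm_apply_apply x
  refine ⟨((Monoid.CoprodI.lift L).comp e.symm.toMonoidHom).comp projPSL, ?_, ?_, ?_⟩
  · have := key (Monoid.CoprodI.of (i := true) (Multiplicative.ofAdd 1))
    rw [Monoid.CoprodI.lift_of, Monoid.CoprodI.lift_of] at this
    have h1 : pslFactor true (Multiplicative.ofAdd 1) = projPSL ModularGroup.S :=
      zhom_one 2 (projPSL ModularGroup.S) psl_SS
    have h2 : L true (Multiplicative.ofAdd 1) = s := zhom_one 2 s hs
    rw [h1, h2] at this
    exact this
  · have := key (Monoid.CoprodI.of (i := false) (Multiplicative.ofAdd 1))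
    rw [Monoid.CoprodI.lift_of, Monoid.CoprodI.lift_of] at this
    have h1 : pslFactor false (Multiplicative.ofAdd 1) =
      projPSL (ModularGroup.S * ModularGroup.T) :=
      zhom_one 3 (projPSL (ModularGroup.S * ModularGroup.T)) psl_UU
    have h2 : L false (Multiplicative.ofAdd 1) = u := zhom_one 3 u hu
    rw [h1, h2] at this
    exact this
  · have : projPSL (-1) = 1 := by rw [proj_neg, map_one]
    simp [this]
section Run

variable {p q : ℕ}

/-- `x ↦ -1/x` componentwise. -/
def sg (x : ZMod p × ZMod q) : ZMod p × ZMod q := (-x.1⁻¹, -x.2⁻¹)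

/-- `x ↦ -1/(x+1)` componentwise. -/
def rh (x : ZMod p × ZMod q) : ZMod p × ZMod q := (-(x.1 + 1)⁻¹, -(x.2 + 1)⁻¹)

/-- generic points -/
def AA (p q : ℕ) : Set (ZMod p × ZMod q) := {x | x.1 ≠ 0 ∧ x.1 ≠ -1 ∧ x.2 ≠ 0 ∧ x.2 ≠ -1}

/-- rooting condition -/
def RtC (Al : Finset ℕ) (x : ZMod p × ZMod q) : Prop :=
  x.2 = 1 ∨ (x.1 = 1 ∧ ∃ d ∈ Al, x.2 = 1 + (d : ZMod q))

variable [Fact p.Prime] [Fact q.Prime]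

theorem sg_sg (x : ZMod p × ZMod q) : sg (sg x) = x := by
  simp [sg, inv_neg]

theorem sg_rh (x : ZMod p × ZMod q) : sg (rh x) = (x.1 + 1, x.2 + 1) := by
  simp [sg, rh, inv_neg]

theorem rho_aux {K : Type} [Field K] (x : K) (h0 : x ≠ 0) (h1 : x ≠ -1) :
    -(x + 1)⁻¹ ≠ 0 ∧ -(x + 1)⁻¹ ≠ -1 ∧ -(-(-(x + 1)⁻¹ + 1)⁻¹ + 1)⁻¹ = x := by
  have h2 : x + 1 ≠ 0 := fun h => h1 (by linear_combination h)
  have e1 : -(x + 1)⁻¹ + 1 = x / (x + 1) := by field_simp; ring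
  refine ⟨by simpa using h2, ?_, ?_⟩
  · intro h
    have : (x + 1)⁻¹ = 1 := by linear_combination -h
    rw [inv_eq_one] at this
    exact h0 (by linear_combination this)
  · rw [e1, inv_div]
    have e2 : -((x + 1) / x) + 1 = -(1 / x) := by field_simp; ring
    rw [e2]; simp [inv_neg]

theorem rh_mem {x : ZMod p × ZMod q} (hx : x ∈ AA p q) : rh x ∈ AA p q := by
  obtain ⟨h1, h2, h3, h4⟩ := hx
  have a := rho_aux x.1 h1 h2
  have b := rho_aux x.2 h3 h4
  exact ⟨a.1, a.2.1, b.1, b.2.1⟩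

theorem rh_rh_rh {x : ZMod p × ZMod q} (hx : x ∈ AA p q) : rh (rh (rh x)) = x := by
  obtain ⟨h1, h2, h3, h4⟩ := hx
  have a := rho_aux x.1 h1 h2
  have b := rho_aux x.2 h3 h4
  exact Prod.ext a.2.2 b.2.2

theorem cast_ne {p : ℕ} {a : ℕ} (h1 : 1 ≤ a) (h2 : a ≤ p - 2) (hp : 2 ≤ p) :
    (a : ZMod p) ≠ 0 ∧ (a : ZMod p) ≠ -1 := by
  constructor
  · intro h
    rw [ZMod.natCast_eq_zero_iff] at h
    have := Nat.le_of_dvd (by omega) h; omega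
  · intro h
    have : ((a + 1 : ℕ) : ZMod p) = 0 := by push_cast; rw [h]; ring
    rw [ZMod.natCast_eq_zero_iff] at this
    have := Nat.le_of_dvd (by omega) this; omega

theorem val_bds {p : ℕ} [Fact p.Prime] (x : ZMod p) (h0 : x ≠ 0) (h1 : x ≠ -1) :
    1 ≤ x.val ∧ x.val ≤ p - 2 := by
  have hlt := ZMod.val_lt x
  constructor
  · rw [Nat.one_le_iff_ne_zero]; intro h; exact h0 ((ZMod.val_eq_zero x).1 h)
  · by_contra h
    apply h1
    have h2 : x.val + 1 = p := by omega
    have h3 : ((x.val + 1 : ℕ) : ZMod p) = 0 := by rw [h2]; simp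
    push_cast at h3
    rw [ZMod.natCast_zmod_val] at h3
    linear_combination h3

theorem rho_eq_of_dvd {p : ℕ} [Fact p.Prime] (a α : ℕ) (h : p ∣ α * (a + 1) + 1) :
    -((a : ZMod p) + 1)⁻¹ = (α : ZMod p) := by
  have h1 : ((α * (a + 1) + 1 : ℕ) : ZMod p) = 0 := (ZMod.natCast_eq_zero_iff _ _).2 h
  push_cast at h1
  have h2 : (a : ZMod p) + 1 ≠ 0 := by intro h0; rw [h0] at h1; simp at h1
  field_simp
  linear_combination -h1

theorem sg_notMem_fst {x : ZMod p × ZMod q} (h : x.1 = 1) : sg x ∉ AA p q := by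
  intro h1; exact h1.2.1 (by simp [sg, h])

theorem sg_notMem_snd {x : ZMod p × ZMod q} (h : x.2 = 1) : sg x ∉ AA p q := by
  intro h1; exact h1.2.2.2 (by simp [sg, h])

theorem elim_all {m : ℕ} {Al J : Finset ℕ} (hp3 : 3 ≤ p) (hm : 1 ≤ m) (hqp : q = p + 2 * m)
    (hc : NumCert p q m Al J) :
    ∃ P, ElimGood (sg (p := p) (q := q)) rh (AA p q) (RtC Al) (AA p q) P := by
  obtain ⟨N, P, hg, hmax⟩ := elimGood_max (D := ZMod p × ZMod q) (σ := sg) (ρ := rh) (A := AA p q)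
    (Rt := RtC Al) sg_sg (fun x hx => rh_mem hx) (fun x hx => rh_rh_rh hx)
  have hA : ∀ a b : ℕ, 1 ≤ a → a ≤ p - 2 → 1 ≤ b → b ≤ q - 2 →
      ((a : ZMod p), (b : ZMod q)) ∈ AA p q := by
    intro a b h1 h2 h3 h4
    have u := cast_ne h1 h2 (by omega)
    have v := cast_ne (p := q) h3 h4 (by omega)
    exact ⟨u.1, u.2, v.1, v.2⟩
  have hback : ∀ x ∈ AA p q, rh x ∈ N → x ∈ N := by
    intro x hx h
    rw [← rh_rh_rh hx]
    exact hg.rho_mem _ (hg.rho_mem _ h)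
  have hdown : ∀ a b : ℕ, ((a : ZMod p), (b : ZMod q)) ∈ N →
      (((a + 1 : ℕ) : ZMod p), ((b + 1 : ℕ) : ZMod q)) ∈ AA p q →
      (((a + 1 : ℕ) : ZMod p), ((b + 1 : ℕ) : ZMod q)) ∈ N := by
    intro a b h1 h2
    apply hmax _ h2
    left
    have : sg (((a + 1 : ℕ) : ZMod p), ((b + 1 : ℕ) : ZMod q)) =
        rh ((a : ZMod p), (b : ZMod q)) := by
      simp [sg, rh]
    rw [this]
    exact hg.rho_mem _ h1
  have hup : ∀ a b : ℕ, (((a + 1 : ℕ) : ZMod p), ((b + 1 : ℕ) : ZMod q)) ∈ N →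
      ((a : ZMod p), (b : ZMod q)) ∈ AA p q → ((a : ZMod p), (b : ZMod q)) ∈ N := by
    intro a b h1 h2
    apply hback _ h2
    apply hmax _ (rh_mem h2)
    left
    rw [sg_rh]; simpa using h1
  have c1 : ∀ a : ℕ, 1 ≤ a → a ≤ p - 2 → ((a : ZMod p), ((1 : ℕ) : ZMod q)) ∈ N := by
    intro a h1 h2
    apply hmax _ (hA a 1 h1 h2 le_rfl (by omega))
    right; left
    exact ⟨sg_notMem_snd (by simp), Or.inl (by simp)⟩
  have c2 : ∀ a : ℕ, 1 ≤ a → a ≤ p - 2 → ((a : ZMod p), ((q - 2 : ℕ) : ZMod q)) ∈ N := by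
    intro a h1 h2
    have hA' := hA a (q - 2) h1 h2 (by omega) le_rfl
    apply hback _ hA'
    apply hmax _ (rh_mem hA')
    right; left
    have : (rh ((a : ZMod p), ((q - 2 : ℕ) : ZMod q))).2 = 1 := by
      change -(((q - 2 : ℕ) : ZMod q) + 1)⁻¹ = 1
      rw [Nat.cast_sub (by omega)]
      simp only [CharP.cast_eq_zero]
      norm_num
    exact ⟨sg_notMem_snd this, Or.inl this⟩
  have c3 : ∀ b a : ℕ, 1 ≤ b → b ≤ a → a ≤ p - 2 → ((a : ZMod p), (b : ZMod q)) ∈ N := by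
    intro b
    induction b with
    | zero => intro a h; omega
    | succ b ih =>
      intro a _ h2 h3
      rcases Nat.eq_zero_or_pos b with rfl | hb
      · exact c1 a (by omega) h3
      · obtain ⟨a, rfl⟩ := Nat.exists_eq_add_of_lt (show 0 < a by omega)
        rw [zero_add] at h2 h3 ⊢
        exact hdown _ _ (ih a hb (by omega) (by omega))
          (hA _ _ (by omega) (by omega) (by omega) (by omega))
  have c4 : ∀ k b a : ℕ, b + k = q - 2 → 1 ≤ a → a + 2 * m ≤ b →
      ((a : ZMod p), (b : ZMod q)) ∈ N := by
    intro k
    induction k with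
    | zero =>
      intro b a h1 h2 h3
      have : b = q - 2 := by omega
      subst this
      exact c2 a h2 (by omega)
    | succ k ih =>
      intro b a h1 h2 h3
      exact hup _ _ (ih (b + 1) (a + 1) (by omega) (by omega) (by omega))
        (hA _ _ (by omega) (by omega) (by omega) (by omega))
  have c5 : ∀ d : ℕ, 1 ≤ d → d ≤ 2 * m - 1 → ∀ a : ℕ, 1 ≤ a → a ≤ p - 2 →
      (((a : ZMod p), ((a + d : ℕ) : ZMod q)) ∈ N ↔
        (((1 : ℕ) : ZMod p), ((1 + d : ℕ) : ZMod q)) ∈ N) := by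
    intro d hd1 hd2 a h1
    induction a, h1 using Nat.le_induction with
    | base => intro _; rfl
    | succ a ha ih =>
      intro h2
      rw [← ih (by omega), show a + 1 + d = a + d + 1 by omega]
      constructor
      · intro h
        exact hup _ _ h (hA _ _ (by omega) (by omega) (by omega) (by omega))
      · intro h
        exact hdown _ _ h (hA _ _ (by omega) (by omega) (by omega) (by omega))
  have c6 : ∀ d : ℕ, 1 ≤ d → d ≤ 2 * m - 1 →
      (((1 : ℕ) : ZMod p), ((1 + d : ℕ) : ZMod q)) ∈ N := by
    intro d h1 h2
    rcases hc.cover d h1 h2 with h | ⟨a, α, β, ha1, ha2, hα1, hα2, hβ1, hβ2, hd1, hd2, h⟩ | ⟨h3, h⟩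
    · apply hmax _ (hA _ _ (by omega) (by omega) (by omega) (by omega))
      right; left
      exact ⟨sg_notMem_fst (by simp), Or.inr ⟨by simp, d, h, by simp⟩⟩
    · rw [← c5 d h1 h2 a ha1 ha2]
      apply hback _ (hA _ _ (by omega) (by omega) (by omega) (by omega))
      have e1 := rho_eq_of_dvd a α hd1
      have e2 := rho_eq_of_dvd (a + d) β hd2
      have : rh ((a : ZMod p), ((a + d : ℕ) : ZMod q)) = ((α : ZMod p), (β : ZMod q)) :=
        Prod.ext e1 e2
      rw [this]
      rcases h with h | h
      · exact c3 β α hβ1 h hα2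
      · exact c4 (q - 2 - β) β α (by omega) hα1 h
    · apply hmax _ (hA _ _ (by omega) (by omega) (by omega) (by omega))
      right; right
      refine ⟨?_, sg_notMem_fst (by simp)⟩
      have e1 := rho_eq_of_dvd (p := p) 1 1 (by rw [h3])
      have e2 := rho_eq_of_dvd (p := q) (1 + d) (1 + d) (by
        convert h using 1; ring)
      exact Prod.ext e1 e2
  have hN : N = AA p q := by
    apply Set.Subset.antisymm hg.subA
    intro x hx
    obtain ⟨a1, a2⟩ := val_bds x.1 hx.1 hx.2.1
    obtain ⟨b1, b2⟩ := val_bds x.2 hx.2.2.1 hx.2.2.2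
    have hx' : x = ((x.1.val : ZMod p), (x.2.val : ZMod q)) := by
      rw [ZMod.natCast_zmod_val, ZMod.natCast_zmod_val]
    rw [hx']
    generalize x.1.val = a at *
    generalize x.2.val = b at *
    rcases le_or_gt b a with h | h
    · exact c3 b a b1 h a2
    rcases le_or_gt (a + 2 * m) b with h' | h'
    · exact c4 (q - 2 - b) b a (by omega) a1 h'
    obtain ⟨d, rfl⟩ := Nat.exists_eq_add_of_le h.le
    rw [c5 d (by omega) (by omega) a a1 a2]
    exact c6 d (by omega) (by omega)
  exact ⟨P, by rw [hN] at hg; exact hg⟩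

end Run

section Comb

variable {p q : ℕ}

/-- The special dart `u t = (1, 1 - 1/t)`. -/
def uu (p q : ℕ) (t : ℕ) : ZMod p × ZMod q := (1, 1 - (t : ZMod q)⁻¹)

/-- Combinatorial outcome: `B` is the set of free darts. -/
structure CombGood (p q m : ℕ) (J : Finset ℕ) (B : Set (ZMod p × ZMod q)) : Prop where
  sub : ∀ t ∈ J, 2 ≤ t ∧ t ≤ q - 2
  card : J.card = 2 * m - 1
  symm : ∀ x, x ∈ B → sg x ∈ B
  ext : ∀ (F : Type) [Group F] (g : ZMod p × ZMod q → F) (k : ℕ → F), (∀ x, g (sg x) * g x = 1) →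
    (∀ x ∈ AA p q, rh x = x → g x * g x * g x = 1) →
    ∃ f : ZMod p × ZMod q → F, (∀ x, f (sg x) * f x = 1) ∧
      (∀ x ∈ AA p q, f x * f (rh x) * f (rh (rh x)) = 1) ∧ (∀ x ∈ B, f x = g x) ∧
      ∀ t ∈ J, f (uu p q t) * f (uu p q (t + 1)) = k t
  gen : ∀ (F : Type) [Group F] (f : ZMod p × ZMod q → F), (∀ x, f (sg x) * f x = 1) →
    (∀ x ∈ AA p q, f x * f (rh x) * f (rh (rh x)) = 1) → ∀ (K : Subgroup F),
    (∀ x ∈ B, f x ∈ K) → (∀ t ∈ J, f (uu p q t) * f (uu p q (t + 1)) ∈ K) → ∀ x, f x ∈ K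

/-- auxiliary recursion -/
def wrec {F : Type} [Group F] (J : Finset ℕ) (k g : ℕ → F) : ℕ → F
  | 0 => 1
  | t + 1 => if t ∈ J then (wrec J k g t)⁻¹ * k t else g (t + 1)

variable [Fact p.Prime] [Fact q.Prime]

theorem tau_uu {t : ℕ} (h2 : t < q) : ((1 - (uu p q t).2)⁻¹).val = t := by
  have : (1 - (uu p q t).2)⁻¹ = (t : ZMod q) := by simp [uu]
  rw [this, ZMod.val_natCast_of_lt h2]

theorem one_ne_neg_one_zmod (hp3 : 3 ≤ p) : (1 : ZMod p) ≠ -1 := by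
  intro h
  have : ((2 : ℕ) : ZMod p) = 0 := by push_cast; linear_combination h
  rw [ZMod.natCast_eq_zero_iff] at this
  have := Nat.le_of_dvd (by omega) this
  omega

theorem comb_exists {m : ℕ} {Al J : Finset ℕ} (hp3 : 3 ≤ p) (hm : 1 ≤ m) (hqp : q = p + 2 * m)
    (hc : NumCert p q m Al J) : ∃ B, CombGood p q m J B := by
  classical
  obtain ⟨P, hg⟩ := elim_all hp3 hm hqp hc
  let Q : Set (ZMod p × ZMod q) := {x | ∃ t ∈ J, x = uu p q (t + 1)}
  have hQ1 : ∀ x ∈ Q, x.1 = 1 := by rintro x ⟨t, _, rfl⟩; rfl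
  have hQs : ∀ x, x ∈ Q → sg x ∉ Q := by
    intro x hx h
    have h1 := hQ1 _ h
    have h2 := hQ1 _ hx
    simp [sg, h2] at h1
    exact one_ne_neg_one_zmod hp3 h1.symm
  have hcast : ∀ t : ℕ, 1 ≤ t → t < q → (t : ZMod q) ≠ 0 := by
    intro t h1 h2 h
    rw [ZMod.natCast_eq_zero_iff] at h
    have := Nat.le_of_dvd (by omega) h
    omega
  have hprot0 : ∀ t : ℕ, 1 ≤ t → t < q → (∀ d ∈ Al, ¬ q ∣ t * d + 1) →
      uu p q t ∉ P ∧ sg (uu p q t) ∉ P := by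
    intro t h1 h2 h3
    have hA : sg (uu p q t) ∉ AA p q := sg_notMem_fst rfl
    constructor
    · intro h
      rcases (hg.parent _ h).2 with h4 | ⟨_, h4⟩
      · exact hA h4
      · have ht := hcast t h1 h2
        rcases h4 with h4 | ⟨_, d, hd, h4⟩
        · simp [uu] at h4
          exact ht h4
        · apply h3 d hd
          rw [← ZMod.natCast_eq_zero_iff]
          push_cast
          have h5 : (d : ZMod q) = -(t : ZMod q)⁻¹ := by
            simp only [uu] at h4; linear_combination -h4
          rw [h5]; field_simp; ring
    · intro h
      exact hA (hg.parent _ h).1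
  have hprot : ∀ t ∈ J, uu p q t ∉ P ∧ sg (uu p q t) ∉ P := fun t ht =>
    hprot0 t (by have := hc.sub t ht; omega) (by have := hc.sub t ht; omega)
      (fun d hd => (hc.avoid t ht d hd).1)
  have hprot' : ∀ t ∈ J, uu p q (t + 1) ∉ P ∧ sg (uu p q (t + 1)) ∉ P := fun t ht =>
    hprot0 (t + 1) (by omega) (by have := hc.sub t ht; omega)
      (fun d hd => (hc.avoid t ht d hd).2)
  have huQ : ∀ t ∈ J, uu p q t ∈ Q → t - 1 ∈ J := by
    rintro t ht ⟨s, hs, h⟩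
    have b1 := hc.sub t ht
    have b2 := hc.sub s hs
    have e1 := tau_uu (p := p) (q := q) (t := t) (by omega)
    rw [h, tau_uu (by omega)] at e1
    have : t - 1 = s := by omega
    rwa [this]
  have huQs : ∀ t, sg (uu p q t) ∉ Q := by
    intro t h
    have h1 := hQ1 _ h
    simp [sg, uu] at h1
    exact one_ne_neg_one_zmod hp3 h1.symm
  let B : Set (ZMod p × ZMod q) := {x | x ∉ P ∧ sg x ∉ P ∧ x ∉ Q ∧ sg x ∉ Q}
  refine ⟨B, hc.sub, hc.card, ?_, ?_, ?_⟩
  · rintro x ⟨h1, h2, h3, h4⟩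
    exact ⟨h2, by rwa [sg_sg], h4, by rwa [sg_sg]⟩
  · intro F _ g k hgs hg3
    let w := wrec J k (fun t => g (uu p q t))
    let τ : ZMod p × ZMod q → ℕ := fun x => ((1 - x.2)⁻¹).val
    let g' : ZMod p × ZMod q → F := fun x =>
      if x ∈ Q then w (τ x) else if sg x ∈ Q then (w (τ (sg x)))⁻¹ else g x
    have hg's : ∀ x, g' (sg x) * g' x = 1 := by
      intro x
      by_cases h1 : x ∈ Q
      · have h2 := hQs x h1
        simp only [g', h1, h2, sg_sg, if_true, if_false, inv_mul_cancel]
      · by_cases h2 : sg x ∈ Q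
        · simp only [g', h1, h2, if_true, if_false, mul_inv_cancel]
        · simp only [g', h1, h2, sg_sg, if_false, hgs]
    have hg'3 : ∀ x ∈ AA p q, rh x = x → g' x * g' x * g' x = 1 := by
      intro x hxA hx
      have h1 : x ∉ Q := by
        rintro ⟨t, ht, rfl⟩
        have b := hc.sub t ht
        have e1 : -((1 : ZMod p) + 1)⁻¹ = 1 := congrArg Prod.fst hx
        have h2 : (1 : ZMod p) + 1 ≠ 0 := fun h => one_ne_neg_one_zmod hp3 (by linear_combination h)
        have e2 : ((3 : ℕ) : ZMod p) = 0 := by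
          push_cast
          field_simp at e1
          linear_combination -e1
        rw [ZMod.natCast_eq_zero_iff] at e2
        have hp : p = 3 := by have := Nat.le_of_dvd (by omega) e2; omega
        apply hc.three t ht hp
        rw [← ZMod.natCast_eq_zero_iff]
        have f1 : (uu p q (t + 1)).2 ≠ 0 := hxA.2.2.1
        have f2 : (uu p q (t + 1)).2 ≠ -1 := hxA.2.2.2
        have e3 : -((uu p q (t + 1)).2 + 1)⁻¹ = (uu p q (t + 1)).2 := congrArg Prod.snd hx
        have f3 : (uu p q (t + 1)).2 + 1 ≠ 0 := fun h => f2 (by linear_combination h)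
        have f4 : ((t + 1 : ℕ) : ZMod q) ≠ 0 := hcast _ (by omega) (by omega)
        have f5 : (uu p q (t + 1)).2 * ((t + 1 : ℕ) : ZMod q) = t := by
          simp only [uu]; rw [sub_mul, inv_mul_cancel₀ f4]; push_cast; ring
        generalize (uu p q (t + 1)).2 = y at *
        have e4 : y * y + y + 1 = 0 := by
          field_simp at e3
          linear_combination -e3
        push_cast at f5 ⊢
        linear_combination ((t : ZMod q) + 1) ^ 2 * e4 - (y * (t + 1) + t + t + 1) * f5
      have h2 : sg x ∉ Q := by
        intro h
        have h3 := hQ1 _ h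
        apply hxA.2.1
        have h4 : -x.1⁻¹ = 1 := h3
        rw [neg_eq_iff_eq_neg] at h4
        rw [← inv_inv x.1, h4]; simp
      simp only [g', h1, h2, if_false]
      exact hg3 x hxA hx
    obtain ⟨f, f1, f2, f3⟩ := hg.ext F g' hg's hg'3
    refine ⟨f, f1, f2, ?_, ?_⟩
    · rintro x ⟨h1, h2, h3, h4⟩
      rw [f3 x h1 h2]
      simp only [g', h3, h4, if_false]
    · intro t ht
      have b := hc.sub t ht
      have hu1 : f (uu p q (t + 1)) = w (t + 1) := by
        rw [f3 _ (hprot' t ht).1 (hprot' t ht).2]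
        have : uu p q (t + 1) ∈ Q := ⟨t, ht, rfl⟩
        simp only [g', this, if_true]
        congr 1
        exact tau_uu (by omega)
      have hu0 : f (uu p q t) = w t := by
        rw [f3 _ (hprot t ht).1 (hprot t ht).2]
        by_cases hQ : uu p q t ∈ Q
        · simp only [g', hQ, if_true]
          congr 1
          exact tau_uu (by omega)
        · simp only [g', hQ, huQs t, if_false]
          obtain ⟨s, rfl⟩ : ∃ s, t = s + 1 := ⟨t - 1, by omega⟩
          have hs : s ∉ J := fun hs => hQ ⟨s, hs, rfl⟩
          simp [w, wrec, hs]
      rw [hu0, hu1]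
      simp [w, wrec, ht]
  · intro F _ f f1 f2 K hB hJ
    have hinv : ∀ x, f (sg x) ∈ K → f x ∈ K := by
      intro x h
      have : f x = (f (sg x))⁻¹ := (inv_eq_of_mul_eq_one_right (f1 x)).symm
      rw [this]; exact inv_mem h
    have key : ∀ t, t ∈ J → f (uu p q (t + 1)) ∈ K := by
      intro t
      induction t with
      | zero => intro h; have := hc.sub _ h; omega
      | succ s ih =>
        intro ht
        have h0 : f (uu p q (s + 1)) ∈ K := by
          by_cases hs : s ∈ J
          · exact ih hs
          · apply hB
            refine ⟨(hprot _ ht).1, (hprot _ ht).2, ?_, huQs _⟩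
            intro h
            exact hs (by simpa using huQ _ ht h)
        have h1 := mul_mem (inv_mem h0) (hJ _ ht)
        rwa [inv_mul_cancel_left] at h1
    apply hg.gen F f f1 f2 K
    intro x hx1 hx2
    by_cases h1 : x ∈ Q
    · obtain ⟨t, ht, rfl⟩ := h1; exact key t ht
    by_cases h2 : sg x ∈ Q
    · apply hinv
      obtain ⟨t, ht, h⟩ := h2; rw [h]; exact key t ht
    exact hB x ⟨hx1, hx2, h1, h2⟩

end Comb

section Cocycle

/-- `z ↦ -1/z` on the projective line. -/
def oS {K : Type} [Field K] [DecidableEq K] : Option K → Option K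
  | none => some 0
  | some x => if x = 0 then none else some (-x⁻¹)

/-- `z ↦ z+1` on the projective line. -/
def oT {K : Type} [Field K] : Option K → Option K
  | none => none
  | some x => some (x + 1)

/-- `z ↦ z-1` on the projective line. -/
def oTi {K : Type} [Field K] : Option K → Option K
  | none => none
  | some x => some (x - 1)

theorem oS_oS {K : Type} [Field K] [DecidableEq K] (z : Option K) : oS (oS z) = z := by
  rcases z with _ | x
  · simp [oS]
  · by_cases h : x = 0
    · simp [oS, h]
    · simp [oS, h, inv_neg]

theorem oT_oTi {K : Type} [Field K] (z : Option K) : oT (oTi z) = z := by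
  rcases z with _ | x <;> simp [oT, oTi]

theorem oTi_oT {K : Type} [Field K] (z : Option K) : oTi (oT z) = z := by
  rcases z with _ | x <;> simp [oT, oTi]

variable {p q : ℕ} [Fact p.Prime] [Fact q.Prime] {F : Type} [Group F]

/-- The pairs of points of the two projective lines. -/
abbrev XX (p q : ℕ) := Option (ZMod p) × Option (ZMod q)

/-- cost of `S` -/
def cS (f : ZMod p × ZMod q → F) : XX p q → F
  | (some x, some y) => if x = 0 ∨ y = 0 then 1 else f (x, y)
  | _ => 1

/-- cost of `T` -/
def cT (f : ZMod p × ZMod q → F) (t k : F) : XX p q → F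
  | (some x, some y) => if x = 0 ∧ y = 0 then t else 1
  | (none, some y) => if y = 0 then 1 else if y = -1 then k else (f (1, y / (y + 1)))⁻¹
  | (some x, none) => if x = -1 then 1 else if x = 0 then k⁻¹ else (f (x / (x + 1), 1))⁻¹
  | (none, none) => (f (1, 1) * t)⁻¹

theorem cS_cS {f : ZMod p × ZMod q → F} (hf : ∀ x, f (sg x) * f x = 1) (z : XX p q) :
    cS f (oS z.1, oS z.2) * cS f z = 1 := by
  obtain ⟨_ | x, _ | y⟩ := z
  · simp [oS, cS]
  · by_cases h : y = 0 <;> simp [oS, cS, h]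
  · by_cases h : x = 0 <;> simp [oS, cS, h]
  · by_cases hx : x = 0
    · simp [oS, cS, hx]
    · by_cases hy : y = 0
      · simp [oS, cS, hx, hy]
      · simpa [oS, cS, hx, hy, sg] using hf (x, y)

/-- Permutation for `S`. -/
def permS (f : ZMod p × ZMod q → F) (hf : ∀ x, f (sg x) * f x = 1) :
    Equiv.Perm (XX p q × F) :=
  Function.Involutive.toPerm (fun a => ((oS a.1.1, oS a.1.2), cS f a.1 * a.2)) (by
    rintro ⟨⟨x, y⟩, w⟩
    have := cS_cS hf (x, y)
    simp only [oS_oS, ← mul_assoc] at this ⊢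
    rw [this, one_mul])

/-- Permutation for `T`. -/
def permT (f : ZMod p × ZMod q → F) (t k : F) : Equiv.Perm (XX p q × F) where
  toFun a := ((oT a.1.1, oT a.1.2), cT f t k a.1 * a.2)
  invFun a := ((oTi a.1.1, oTi a.1.2), (cT f t k (oTi a.1.1, oTi a.1.2))⁻¹ * a.2)
  left_inv := by rintro ⟨⟨x, y⟩, w⟩; simp [oTi_oT]
  right_inv := by rintro ⟨⟨x, y⟩, w⟩; simp [oT_oTi]

/-- rotation on the projective line -/
def oR {K : Type} [Field K] [DecidableEq K] (z : Option K) : Option K := oS (oT z)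

/-- cost of the rotation -/
def cR (f : ZMod p × ZMod q → F) (t k : F) (z : XX p q) : F :=
  cS f (oT z.1, oT z.2) * cT f t k z

theorem oR_none {K : Type} [Field K] [DecidableEq K] : oR (none : Option K) = some 0 := by
  simp [oR, oS, oT]
theorem oR_zero {K : Type} [Field K] [DecidableEq K] : oR (some 0 : Option K) = some (-1) := by
  simp [oR, oS, oT]
theorem oR_neg {K : Type} [Field K] [DecidableEq K] : oR (some (-1) : Option K) = none := by
  simp [oR, oS, oT]
theorem oR_gen {K : Type} [Field K] [DecidableEq K] {x : K} (h : x ≠ -1) :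
    oR (some x : Option K) = some (-(x + 1)⁻¹) := by
  have : x + 1 ≠ 0 := fun h' => h (by linear_combination h')
  simp [oR, oS, oT, this]

theorem oR3 {K : Type} [Field K] [DecidableEq K] (z : Option K) : oR (oR (oR z)) = z := by
  rcases z with _ | x
  · rw [oR_none, oR_zero, oR_neg]
  by_cases h0 : x = 0
  · subst h0; rw [oR_zero, oR_neg, oR_none]
  by_cases h1 : x = -1
  · subst h1; rw [oR_neg, oR_none, oR_zero]
  obtain ⟨a, b, c⟩ := rho_aux x h0 h1
  obtain ⟨a', b', c'⟩ := rho_aux _ a b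
  rw [oR_gen h1, oR_gen b, oR_gen b', c]

theorem oR_cases {K : Type} [Field K] [DecidableEq K] (z : Option K) :
    z = none ∨ z = some 0 ∨ z = some (-1) ∨ ∃ x, x ≠ 0 ∧ x ≠ -1 ∧ z = some x := by
  rcases z with _ | x
  · simp
  by_cases h0 : x = 0
  · simp [h0]
  by_cases h1 : x = -1
  · simp [h1]
  exact Or.inr (Or.inr (Or.inr ⟨x, h0, h1, rfl⟩))

theorem rot_rel {F : Type} [Group F] {a b c : F} (h : a * b * c = 1) : b * c * a = 1 := by
  have h1 : a = (b * c)⁻¹ := eq_inv_of_mul_eq_one_left (by rw [← mul_assoc]; exact h)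
  rw [h1]; simp

variable {f : ZMod p × ZMod q → F} {t k : F}

theorem cR_none_none : cR f t k (none, none) = (f (1, 1) * t)⁻¹ := by
  simp [cR, cS, cT, oT]

theorem cR_zero_zero : cR f t k (some 0, some 0) = f (1, 1) * t := by
  simp [cR, cS, cT, oT]

theorem cR_neg_neg : cR f t k (some (-1), some (-1)) = 1 := by
  simp [cR, cS, cT, oT]

/-- the rotation relation at a point -/
def RelAt (f : ZMod p × ZMod q → F) (t k : F) (a : Option (ZMod p)) (b : Option (ZMod q)) : Prop :=
  cR f t k (oR (oR a), oR (oR b)) * cR f t k (oR a, oR b) * cR f t k (a, b) = 1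

theorem cR_rel1 {a : Option (ZMod p)} {b : Option (ZMod q)} (h : RelAt f t k a b) :
    RelAt f t k (oR a) (oR b) := by
  unfold RelAt at *
  rw [oR3, oR3]
  exact rot_rel (rot_rel h)

theorem cR_rel (hf : ∀ x, f (sg x) * f x = 1)
    (hr : ∀ x ∈ AA p q, f x * f (rh x) * f (rh (rh x)) = 1) (z : XX p q) :
    RelAt f t k z.1 z.2 := by
  have hnn : RelAt f t k none none := by
    unfold RelAt
    simp [oR_none, oR_zero, cR, cS, cT, oT]
  have hn0 : RelAt f t k none (some 0) := by
    unfold RelAt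
    simp [oR_none, oR_zero, oR_neg, cR, cS, cT, oT]
  have hn1 : RelAt f t k none (some (-1)) := by
    unfold RelAt
    simp [oR_none, oR_zero, oR_neg, cR, cS, cT, oT]
  have hny : ∀ y : ZMod q, y ≠ 0 → y ≠ -1 → RelAt f t k none (some y) := by
    intro y h0 h1
    obtain ⟨a, b, c⟩ := rho_aux y h0 h1
    have h2 : y + 1 ≠ 0 := fun h' => h1 (by linear_combination h')
    have e : -(y + 1)⁻¹ + 1 = y / (y + 1) := by field_simp; ring
    unfold RelAt
    rw [oR_gen h1, oR_gen b, oR_none, oR_zero]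
    simp [cR, cS, cT, oT, h0, h1, h2, e]
  have hxn : ∀ x : ZMod p, x ≠ 0 → x ≠ -1 → RelAt f t k (some x) none := by
    intro y h0 h1
    obtain ⟨a, b, c⟩ := rho_aux y h0 h1
    have h2 : y + 1 ≠ 0 := fun h' => h1 (by linear_combination h')
    have e : -(y + 1)⁻¹ + 1 = y / (y + 1) := by field_simp; ring
    unfold RelAt
    rw [oR_gen h1, oR_gen b, oR_none, oR_zero]
    simp [cR, cS, cT, oT, h0, h1, h2, e]
  have hxy : ∀ (x : ZMod p) (y : ZMod q), x ≠ 0 → x ≠ -1 → y ≠ 0 → y ≠ -1 →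
      RelAt f t k (some x) (some y) := by
    have hgen : ∀ (x : ZMod p) (y : ZMod q), x ≠ 0 → x ≠ -1 → y ≠ 0 → y ≠ -1 →
        cR f t k (some x, some y) = (f (rh (x, y)))⁻¹ := by
      intro x y x0 x1 y0 y1
      have x2 : x + 1 ≠ 0 := fun h' => x1 (by linear_combination h')
      have y2 : y + 1 ≠ 0 := fun h' => y1 (by linear_combination h')
      have := hf (rh (x, y))
      rw [sg_rh] at this
      rw [← eq_inv_of_mul_eq_one_left this]
      simp [cR, cS, cT, oT, x0, x2, y2]
    intro x y x0 x1 y0 y1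
    obtain ⟨a, b, c⟩ := rho_aux x x0 x1
    obtain ⟨a', b', c'⟩ := rho_aux y y0 y1
    obtain ⟨a2, b2, c2⟩ := rho_aux _ a b
    obtain ⟨a2', b2', c2'⟩ := rho_aux _ a' b'
    unfold RelAt
    rw [oR_gen x1, oR_gen y1, oR_gen b, oR_gen b', hgen _ _ x0 x1 y0 y1, hgen _ _ a b a' b',
      hgen _ _ a2 b2 a2' b2']
    have hA : (x, y) ∈ AA p q := ⟨x0, x1, y0, y1⟩
    have h3 := rh_rh_rh hA
    have h4 : rh (-(-(x + 1)⁻¹ + 1)⁻¹, -(-(y + 1)⁻¹ + 1)⁻¹) = (x, y) := h3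
    have h5 : rh (-(x + 1)⁻¹, -(y + 1)⁻¹) = rh (rh (x, y)) := rfl
    rw [h4, h5, ← _root_.mul_inv_rev, ← _root_.mul_inv_rev, inv_eq_one]
    have := rot_rel (hr _ hA)
    rwa [mul_assoc] at this
  obtain ⟨z1, z2⟩ := z
  rcases oR_cases z1 with rfl | rfl | rfl | ⟨x, x0, x1, rfl⟩ <;>
  rcases oR_cases z2 with rfl | rfl | rfl | ⟨y, y0, y1, rfl⟩
  · exact hnn
  · exact hn0
  · exact hn1
  · exact hny y y0 y1
  · have := cR_rel1 hn1
    simpa only [oR_none, oR_neg] using this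
  · have := cR_rel1 hnn
    simpa only [oR_none, oR_neg] using this
  · have := cR_rel1 hn0
    simpa only [oR_none, oR_zero] using this
  · obtain ⟨a, b, c⟩ := rho_aux y y0 y1
    obtain ⟨a2, b2, c2⟩ := rho_aux _ a b
    have := cR_rel1 (hny _ a2 b2)
    simpa only [oR_none, oR_gen b2, c] using this
  · have := cR_rel1 (cR_rel1 hn0)
    simpa only [oR_none, oR_zero, oR_neg] using this
  · have := cR_rel1 (cR_rel1 hn1)
    simpa only [oR_none, oR_zero, oR_neg] using this
  · have := cR_rel1 (cR_rel1 hnn)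
    simpa only [oR_none, oR_zero, oR_neg] using this
  · obtain ⟨a, b, c⟩ := rho_aux y y0 y1
    have := cR_rel1 (cR_rel1 (hny _ a b))
    obtain ⟨a2, b2, c2⟩ := rho_aux _ a b
    simpa only [oR_none, oR_zero, oR_gen b, oR_gen b2, c] using this
  · exact hxn x x0 x1
  · obtain ⟨a, b, c⟩ := rho_aux x x0 x1
    obtain ⟨a2, b2, c2⟩ := rho_aux _ a b
    have := cR_rel1 (hxn _ a2 b2)
    simpa only [oR_none, oR_gen b2, c] using this
  · obtain ⟨a, b, c⟩ := rho_aux x x0 x1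
    have := cR_rel1 (cR_rel1 (hxn _ a b))
    obtain ⟨a2, b2, c2⟩ := rho_aux _ a b
    simpa only [oR_none, oR_zero, oR_gen b, oR_gen b2, c] using this
  · exact hxy x y x0 x1 y0 y1

theorem cocycle_hom (hf : ∀ x, f (sg x) * f x = 1)
    (hr : ∀ x ∈ AA p q, f x * f (rh x) * f (rh (rh x)) = 1) (t k : F) :
    ∃ Θ : SL2Z →* Equiv.Perm (XX p q × F), Θ ModularGroup.S = permS f hf ∧
      Θ ModularGroup.T = permT f t k ∧ Θ (-1) = 1 := by
  obtain ⟨Θ, h1, h2, h3⟩ := psl_presentation (permS f hf) (permS f hf * permT f t k) (by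
      ext1 a
      rw [sq]
      change permS f hf (permS f hf a) = a
      exact Function.Involutive.toPerm_involutive _ a) (by
      ext1 a
      obtain ⟨z, w⟩ := a
      have key : ∀ z w, (permS f hf * permT f t k) (z, w) =
          ((oR z.1, oR z.2), cR f t k z * w) := by
        intro z w
        rw [Equiv.Perm.mul_apply]
        change ((oS (oT z.1), oS (oT z.2)), cS f (oT z.1, oT z.2) * (cT f t k z * w)) = _
        simp [oR, cR, mul_assoc]
      have h : cR f t k (oR (oR z.1), oR (oR z.2)) * cR f t k (oR z.1, oR z.2) * cR f t k z = 1 :=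
        cR_rel (t := t) (k := k) hf hr z
      rw [pow_succ, sq, Equiv.Perm.mul_apply, Equiv.Perm.mul_apply, key, key, key]
      simp only [oR3, ← mul_assoc]
      rw [h]; simp)
  refine ⟨Θ, h1, ?_, h3⟩
  rw [map_mul, h1] at h2
  exact mul_left_cancel h2

end Cocycle

section Cover

open ModularGroup

theorem tst1 (a b : ℤ) : T ^ a * S * T ^ b * (T ^ (-b) * S * T ^ (-a)) = -1 := by
  apply sl_ext <;> rw [neg_e] <;>
    simp only [e00, e01, e10, e11, S00, S01, S10, S11, T00, T01, T10, T11] <;> simp <;> try ring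

theorem tst2 (a b c : ℤ) :
    T ^ a * S * T ^ b * (T ^ (-b - 1) * S * T ^ c) * (T ^ (-c - 1) * S * T ^ (-a - 1)) = 1 := by
  apply sl_ext <;>
    simp only [e00, e01, e10, e11, S00, S01, S10, S11, T00, T01, T10, T11] <;> simp <;> ring

theorem tst3 (a b c d : ℤ) (h : b + c = 2) :
    T ^ a * S * T ^ b * (T ^ c * S * T ^ d) = T ^ a * S * T ^ (2 : ℤ) * S * T ^ d := by
  rw [← h, _root_.zpow_add]; group

theorem tst_e00 (a b : ℤ) : (T ^ a * S * T ^ b) 0 0 = a := by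
  simp only [e00, e01, e10, e11, S00, S01, S10, S11, T00, T01, T10, T11]; ring
theorem tst_e01 (a b : ℤ) : (T ^ a * S * T ^ b) 0 1 = a * b - 1 := by
  simp only [e00, e01, e10, e11, S00, S01, S10, S11, T00, T01, T10, T11]; ring
theorem tst_e10 (a b : ℤ) : (T ^ a * S * T ^ b) 1 0 = 1 := by
  simp only [e00, e01, e10, e11, S00, S01, S10, S11, T00, T01, T10, T11]; ring
theorem tst_e11 (a b : ℤ) : (T ^ a * S * T ^ b) 1 1 = b := by
  simp only [e00, e01, e10, e11, S00, S01, S10, S11, T00, T01, T10, T11]; ring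

theorem ttt_e00 (a b : ℤ) : (T ^ a * S * T ^ (2 : ℤ) * S * T ^ b) 0 0 = 2 * a - 1 := by
  simp only [e00, e01, e10, e11, S00, S01, S10, S11, T00, T01, T10, T11]; ring
theorem ttt_e01 (a b : ℤ) : (T ^ a * S * T ^ (2 : ℤ) * S * T ^ b) 0 1 = (2 * a - 1) * b - a := by
  simp only [e00, e01, e10, e11, S00, S01, S10, S11, T00, T01, T10, T11]; ring
theorem ttt_e10 (a b : ℤ) : (T ^ a * S * T ^ (2 : ℤ) * S * T ^ b) 1 0 = 2 := by
  simp only [e00, e01, e10, e11, S00, S01, S10, S11, T00, T01, T10, T11]; ring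
theorem ttt_e11 (a b : ℤ) : (T ^ a * S * T ^ (2 : ℤ) * S * T ^ b) 1 1 = 2 * b - 1 := by
  simp only [e00, e01, e10, e11, S00, S01, S10, S11, T00, T01, T10, T11]; ring

/-- matrices reached by the coset enumeration -/
def Reach (p q : ℤ) (L : Subgroup SL2Z) (g : SL2Z) : Prop :=
  ∃ (j : ℤ) (δ : SL2Z), δ ∈ L ∧ (g = T ^ j * δ ∨ g = S * T ^ j * δ ∨
    (p ∣ j ∧ q ∣ j - 1 ∧ g = T * S * T ^ j * δ) ∨ (p ∣ j + 1 ∧ q ∣ j ∧ g = T⁻¹ * S * T ^ j * δ))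

theorem cover_all (p q : ℤ) (hp : Prime p) (hq : Prime q) (hpq : IsCoprime p q)
    (L : Subgroup SL2Z) (hneg : -1 ∈ L) (hTn : T ^ (p * q) ∈ L)
    (hunit : ∀ j j' : ℤ, p * q ∣ j * j' + 1 → T ^ (-j') * S * T ^ j ∈ L) (e : ℤ) (he1 : p ∣ e)
    (he2 : q ∣ e - 1) (hk : T ^ e * S * T ^ (2 : ℤ) * S * T ^ (e - p * q) ∈ L)
    (hL : ∀ δ ∈ L, p * q ∣ δ 0 1) (g : SL2Z) (hg : p * q ∣ g 0 1) : g ∈ L := by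
  have hTm : ∀ i : ℤ, p * q ∣ i → T ^ i ∈ L := by
    rintro i ⟨c, rfl⟩
    rw [_root_.zpow_mul]; exact zpow_mem hTn c
  have hneg' : ∀ δ : SL2Z, δ ∈ L → -δ ∈ L := by
    intro δ h
    have : -δ = -1 * δ := by simp
    rw [this]; exact mul_mem hneg h
  -- unit case
  have hU : ∀ j : ℤ, ¬ p ∣ j → ¬ q ∣ j → ∃ j' : ℤ, ∃ δ ∈ L, S * T ^ j = T ^ j' * δ := by
    intro j h1 h2
    have c1 : IsCoprime p j := (Prime.coprime_iff_not_dvd hp).2 h1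
    have c2 : IsCoprime q j := (Prime.coprime_iff_not_dvd hq).2 h2
    obtain ⟨u, v, huv⟩ := IsCoprime.mul_left c1 c2
    refine ⟨-v, _, hunit j (-v) ⟨u, by linear_combination -huv⟩, ?_⟩
    simp only [neg_neg, ← mul_assoc, ← _root_.zpow_add]
    simp
  have hK1 : ∀ j : ℤ, p ∣ j → q ∣ j - 1 → ∃ i : ℤ, ∃ δ ∈ L,
      T ^ (2 : ℤ) * S * T ^ j = S * T ^ i * δ := by
    intro j h1 h2
    have hd : p * q ∣ j - (e - p * q) := by
      apply IsCoprime.mul_dvd hpq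
      · exact dvd_sub h1 (dvd_sub he1 (Dvd.intro _ rfl))
      · have : j - (e - p * q) = (j - 1) - (e - 1) + p * q := by ring
        rw [this]; exact dvd_add (dvd_sub h2 he2) (Dvd.intro_left _ rfl)
    refine ⟨-e, -(T ^ e * S * T ^ (2 : ℤ) * S * T ^ (e - p * q) * T ^ (j - (e - p * q))),
      hneg' _ (mul_mem hk (hTm _ hd)), ?_⟩
    apply sl_ext <;>
      simp only [neg_e, e00, e01, e10, e11, S00, S01, S10, S11, T00, T01, T10, T11] <;> ring
  have hK2 : ∀ j : ℤ, p ∣ j - 1 → q ∣ j → ∃ i : ℤ, p ∣ i + 1 ∧ q ∣ i ∧ ∃ δ ∈ L,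
      T ^ (2 : ℤ) * S * T ^ j = S * T ^ i * δ := by
    intro j h1 h2
    have hd : p * q ∣ j - (1 - e) := by
      apply IsCoprime.mul_dvd hpq
      · have : j - (1 - e) = (j - 1) + e := by ring
        rw [this]; exact dvd_add h1 he1
      · have : j - (1 - e) = j + (e - 1) := by ring
        rw [this]; exact dvd_add h2 he2
    refine ⟨e - p * q - 1, ?_, ?_,
      (T ^ e * S * T ^ (2 : ℤ) * S * T ^ (e - p * q))⁻¹ * T ^ (j - (1 - e)),
      mul_mem (inv_mem hk) (hTm _ hd), ?_⟩
    · have : e - p * q - 1 + 1 = e - p * q := by ring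
      rw [this]; exact dvd_sub he1 (Dvd.intro _ rfl)
    · have : e - p * q - 1 = e - 1 - p * q := by ring
      rw [this]; exact dvd_sub he2 (Dvd.intro_left _ rfl)
    · have hinv : (T ^ e * S * T ^ (2 : ℤ) * S * T ^ (e - p * q))⁻¹ =
          T ^ (-(e - p * q)) * S * T ^ (-2 : ℤ) * S * T ^ (-e) := by
        rw [inv_eq_iff_mul_eq_one]
        apply sl_ext <;>
          simp only [neg_e, e00, e01, e10, e11, S00, S01, S10, S11, T00, T01, T10, T11] <;>
          simp <;> ring
      rw [hinv]
      apply sl_ext <;>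
        simp only [neg_e, e00, e01, e10, e11, S00, S01, S10, S11, T00, T01, T10, T11] <;> ring
  have hT : ∀ g, Reach p q L g → Reach p q L (T * g) := by
    rintro g ⟨j, δ, hδ, rfl | rfl | ⟨h1, h2, rfl⟩ | ⟨h1, h2, rfl⟩⟩
    · refine ⟨1 + j, δ, hδ, Or.inl ?_⟩
      rw [_root_.zpow_add, zpow_one, mul_assoc]
    · by_cases hu : ¬ p ∣ j ∧ ¬ q ∣ j
      · obtain ⟨j', δ', h', e'⟩ := hU j hu.1 hu.2
        refine ⟨1 + j', δ' * δ, mul_mem h' hδ, Or.inl ?_⟩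
        rw [e', _root_.zpow_add, zpow_one]; simp only [mul_assoc]
      by_cases hu1 : ¬ p ∣ j - 1 ∧ ¬ q ∣ j - 1
      · obtain ⟨j', δ', h', e'⟩ := hU (j - 1) hu1.1 hu1.2
        refine ⟨-1 + j', -(δ' * δ), hneg' _ (mul_mem h' hδ), Or.inr (Or.inl ?_)⟩
        have : S * T ^ (-1 + j') * -(δ' * δ) = -(S * T ^ (-1 : ℤ) * (T ^ j' * δ') * δ) := by
          rw [_root_.zpow_add]; simp only [mul_assoc, mul_neg]
        rw [this, ← e']
        rw [show -(S * T ^ (-1 : ℤ) * (S * T ^ (j - 1)) * δ) =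
          -(S * T ^ (-1 : ℤ) * (S * T ^ (j - 1))) * δ by simp, ← mul_assoc]
        congr 1
        apply sl_ext <;>
          simp only [neg_e, e00, e01, e10, e11, S00, S01, S10, S11, T00, T01, T10, T11,
            T00', T01', T10', T11'] <;> ring
      have hcase : (p ∣ j ∧ q ∣ j - 1) ∨ (p ∣ j - 1 ∧ q ∣ j) := by
        have hp1 : ¬ (p ∣ j ∧ p ∣ j - 1) := fun h => hp.not_dvd_one (by
          have := dvd_sub h.1 h.2; simpa using this)
        have hq1 : ¬ (q ∣ j ∧ q ∣ j - 1) := fun h => hq.not_dvd_one (by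
          have := dvd_sub h.1 h.2; simpa using this)
        tauto
      rcases hcase with ⟨h1, h2⟩ | ⟨h1, h2⟩
      · refine ⟨j, δ, hδ, Or.inr (Or.inr (Or.inl ⟨h1, h2, ?_⟩))⟩
        simp only [mul_assoc]
      · obtain ⟨i, i1, i2, δ', h', e'⟩ := hK2 j h1 h2
        refine ⟨i, δ' * δ, mul_mem h' hδ, Or.inr (Or.inr (Or.inr ⟨i1, i2, ?_⟩))⟩
        have : T⁻¹ * S * T ^ i * (δ' * δ) = T⁻¹ * (S * T ^ i * δ') * δ := by group
        rw [this, ← e']; group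
    · obtain ⟨i, δ', h', e'⟩ := hK1 j h1 h2
      refine ⟨i, δ' * δ, mul_mem h' hδ, Or.inr (Or.inl ?_)⟩
      have e2 : S * T ^ i * (δ' * δ) = (S * T ^ i * δ') * δ := by group
      rw [e2, ← e', _root_.zpow_two]; simp only [mul_assoc]
    · refine ⟨j, δ, hδ, Or.inr (Or.inl ?_)⟩
      group
  have hS : ∀ g, Reach p q L g → Reach p q L (S * g) := by
    rintro g ⟨j, δ, hδ, rfl | rfl | ⟨h1, h2, rfl⟩ | ⟨h1, h2, rfl⟩⟩
    · exact ⟨j, δ, hδ, Or.inr (Or.inl (by rw [mul_assoc]))⟩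
    · refine ⟨j, -δ, hneg' _ hδ, Or.inl ?_⟩
      have : T ^ j * -δ = -T ^ j * δ := by simp
      rw [this, ← mul_assoc]
      congr 1
      apply sl_ext <;>
        simp only [neg_e, e00, e01, e10, e11, S00, S01, S10, S11, T00, T01, T10, T11] <;> ring
    · refine ⟨j - 1, δ, hδ, Or.inr (Or.inr (Or.inr ⟨by simpa using h1, h2, ?_⟩))⟩
      rw [← mul_assoc]
      congr 1
      rw [← zpow_neg_one T]
      apply sl_ext <;>
        simp only [neg_e, e00, e01, e10, e11, S00, S01, S10, S11, T00, T01, T10, T11,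
          T00', T01', T10', T11'] <;> ring
    · refine ⟨j + 1, -δ, hneg' _ hδ, Or.inr (Or.inr (Or.inl ⟨h1, by simpa using h2, ?_⟩))⟩
      have : T * S * T ^ (j + 1) * -δ = -(T * S * T ^ (j + 1)) * δ := by simp
      rw [this, ← mul_assoc]
      congr 1
      rw [← zpow_neg_one T]
      apply sl_ext <;>
        simp only [neg_e, e00, e01, e10, e11, S00, S01, S10, S11, T00, T01, T10, T11,
          T00', T01', T10', T11'] <;> ring
  have hall : Reach p q L g := by
    have hmem : g ∈ Subgroup.closure {S, T} := by
      rw [SpecialLinearGroup.SL2Z_generators]; trivial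
    have h0 : ∀ x ∈ Subgroup.closure {S, T}, ∀ y, Reach p q L y → Reach p q L (x * y) := by
      intro x hx
      induction hx using Subgroup.closure_induction'' with
      | mem x hx =>
        rcases hx with rfl | rfl
        · exact hS
        · exact hT
      | inv_mem x hx =>
        rcases hx with rfl | rfl
        · intro y hy
          have : S⁻¹ * y = S * (S * (S * y)) := by
            rw [← mul_assoc, ← mul_assoc]
            congr 1
            rw [inv_eq_iff_mul_eq_one]
            apply sl_ext <;>
              simp only [neg_e, e00, e01, e10, e11, S00, S01, S10, S11] <;> simp
          rw [this]; exact hS _ (hS _ (hS _ hy))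
        · intro y hy
          have : T⁻¹ * y = S * (S * (S * (T * (S * (T * (S * y)))))) := by
            simp only [← mul_assoc]
            congr 1
            rw [inv_eq_iff_mul_eq_one]
            apply sl_ext <;>
              simp only [neg_e, e00, e01, e10, e11, S00, S01, S10, S11, T00', T01', T10', T11'] <;>
              simp
          rw [this]
          exact hS _ (hS _ (hS _ (hT _ (hS _ (hT _ (hS _ hy))))))
      | one => intro y hy; rwa [one_mul]
      | mul x y _ _ hx hy => intro z hz; rw [mul_assoc]; exact hx _ (hy _ hz)
    have := h0 g hmem 1 ⟨0, 1, one_mem _, Or.inl (by simp)⟩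
    rwa [mul_one] at this
  obtain ⟨j, δ, hδ, h⟩ := hall
  have hd := hL δ hδ
  have hdet := sl_det δ
  have hcop : IsCoprime (p * q) (δ 1 1) := by
    obtain ⟨c, hc⟩ := hd
    rw [hc] at hdet
    exact ⟨-c * δ 1 0, δ 0 0, by linear_combination hdet⟩
  rcases h with rfl | rfl | ⟨h1, h2, rfl⟩ | ⟨h1, h2, rfl⟩
  · have : (T ^ j * δ) 0 1 = δ 0 1 + j * δ 1 1 := by
      simp only [e01, T00, T01]; ring
    rw [this, dvd_add_right hd] at hg
    exact mul_mem (hTm j (hcop.dvd_of_dvd_mul_right hg)) hδ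
  · exfalso
    have : (S * T ^ j * δ) 0 1 = (-1) * δ 1 1 := by
      simp only [e00, e01, e10, e11, S00, S01, S10, S11, T00, T01, T10, T11]; ring
    rw [this] at hg
    have h3 := hcop.dvd_of_dvd_mul_right hg
    have : p ∣ -1 := (Dvd.intro _ rfl).trans h3
    exact hp.not_dvd_one (by simpa using this)
  · exfalso
    have : (T * S * T ^ j * δ) 0 1 = δ 0 1 + (j - 1) * δ 1 1 := by
      simp only [e00, e01, e10, e11, S00, S01, S10, S11, T00, T01, T10, T11,
        T00', T01', T10', T11']; ring
    rw [this, dvd_add_right hd] at hg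
    have h3 := (Dvd.intro q rfl : p ∣ p * q).trans (hcop.dvd_of_dvd_mul_right hg)
    exact hp.not_dvd_one (by have := dvd_sub h1 h3; simpa using this)
  · exfalso
    have : (T⁻¹ * S * T ^ j * δ) 0 1 = (-1) * (δ 0 1 + (j + 1) * δ 1 1) := by
      rw [← zpow_neg_one T]
      simp only [e00, e01, e10, e11, S00, S01, S10, S11, T00, T01, T10, T11]; ring
    rw [this, neg_one_mul, dvd_neg, dvd_add_right hd] at hg
    have h3 := (Dvd.intro_left p rfl : q ∣ p * q).trans (hcop.dvd_of_dvd_mul_right hg)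
    exact hq.not_dvd_one (by have := dvd_sub h3 h2; simpa using this)

end Cover

section Nu

open ModularGroup

/-- `nu` picks the representative between `1` and `n = p * q`. -/
def IsNu (p q : ℕ) (nu : ZMod p × ZMod q → ℤ) : Prop :=
  ∀ x, 1 ≤ nu x ∧ nu x ≤ (p : ℤ) * q ∧ ((nu x : ℤ) : ZMod p) = x.1 ∧ ((nu x : ℤ) : ZMod q) = x.2

variable {p q : ℕ} [Fact p.Prime] [Fact q.Prime]

theorem nu_exists (hc : Nat.Coprime p q) : ∃ nu : ZMod p × ZMod q → ℤ, IsNu p q nu := by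
  have : ∀ x : ZMod p × ZMod q, ∃ v : ℤ, 1 ≤ v ∧ v ≤ (p : ℤ) * q ∧ ((v : ℤ) : ZMod p) = x.1 ∧
      ((v : ℤ) : ZMod q) = x.2 := by
    rintro ⟨x, y⟩
    have hp0 : (0 : ℤ) < p := by exact_mod_cast (Fact.out : p.Prime).pos
    have hq0 : (0 : ℤ) < q := by exact_mod_cast (Fact.out : q.Prime).pos
    have hn : (0 : ℤ) < (p : ℤ) * q := mul_pos hp0 hq0
    obtain ⟨k, hk1, hk2⟩ := Nat.chineseRemainder hc x.val y.val
    refine ⟨((k : ℤ) - 1) % ((p : ℤ) * q) + 1, ?_, ?_, ?_, ?_⟩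
    · have := Int.emod_nonneg ((k : ℤ) - 1) hn.ne'
      omega
    · have := Int.emod_lt_of_pos ((k : ℤ) - 1) hn
      omega
    · rw [Int.emod_def]
      have := (ZMod.natCast_eq_natCast_iff _ _ _).2 hk1
      push_cast
      rw [this]; simp
    · rw [Int.emod_def]
      have := (ZMod.natCast_eq_natCast_iff _ _ _).2 hk2
      push_cast
      rw [this]; simp
  choose nu h using this
  exact ⟨nu, h⟩

theorem nu_unique {nu} (hnu : IsNu p q nu) (hc : Nat.Coprime p q) {x : ZMod p × ZMod q} {v : ℤ}
    (h1 : 1 ≤ v) (h2 : v ≤ (p : ℤ) * q) (h3 : (v : ZMod p) = x.1) (h4 : (v : ZMod q) = x.2) :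
    nu x = v := by
  obtain ⟨a1, a2, a3, a4⟩ := hnu x
  have d1 : (p : ℤ) ∣ nu x - v := by
    rw [← ZMod.intCast_zmod_eq_zero_iff_dvd]; push_cast; rw [a3, h3]; simp
  have d2 : (q : ℤ) ∣ nu x - v := by
    rw [← ZMod.intCast_zmod_eq_zero_iff_dvd]; push_cast; rw [a4, h4]; simp
  have d3 : (p : ℤ) * q ∣ nu x - v := IsCoprime.mul_dvd (Nat.isCoprime_iff_coprime.2 hc) d1 d2
  have := Int.eq_zero_of_abs_lt_dvd d3 (by rw [abs_lt]; constructor <;> linarith)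
  linarith

theorem nu_lt {nu} (hnu : IsNu p q nu) {x : ZMod p × ZMod q} (hx : ¬ (x.1 = 0 ∧ x.2 = 0)) :
    nu x < (p : ℤ) * q := by
  obtain ⟨a1, a2, a3, a4⟩ := hnu x
  refine lt_of_le_of_ne a2 fun h => hx ?_
  rw [← a3, ← a4, h]; simp

theorem nu_succ {nu} (hnu : IsNu p q nu) (hc : Nat.Coprime p q) {x : ZMod p × ZMod q}
    (hx : ¬ (x.1 = 0 ∧ x.2 = 0)) : nu (x.1 + 1, x.2 + 1) = nu x + 1 := by
  have := nu_lt hnu hx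
  obtain ⟨a1, a2, a3, a4⟩ := hnu x
  apply nu_unique hnu hc
  · linarith
  · linarith
  · push_cast; rw [a3]
  · push_cast; rw [a4]

/-- the basic elements -/
def hh (p q : ℕ) (nu : ZMod p × ZMod q → ℤ) (x : ZMod p × ZMod q) : SL2Z :=
  T ^ ((p : ℤ) * q - nu (sg x)) * S * T ^ (nu x - (p : ℤ) * q)

theorem hh_sg (nu) (x : ZMod p × ZMod q) : hh p q nu (sg x) * hh p q nu x = -1 := by
  unfold hh
  rw [sg_sg, ← tst1 ((p : ℤ) * q - nu x) (nu (sg x) - (p : ℤ) * q)]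
  simp only [neg_sub]

theorem hh_rh {nu} (hnu : IsNu p q nu) (hc : Nat.Coprime p q) {x : ZMod p × ZMod q}
    (hx : x ∈ AA p q) :
    hh p q nu x * hh p q nu (rh x) * hh p q nu (rh (rh x)) = 1 := by
  have h2 := rh_mem hx
  have h3 := rh_mem h2
  have e1 := nu_succ hnu hc (x := x) (fun h => hx.1 h.1)
  have e2 := nu_succ hnu hc (x := rh x) (fun h => h2.1 h.1)
  have e3 := nu_succ hnu hc (x := rh (rh x)) (fun h => h3.1 h.1)
  rw [← sg_rh] at e1 e2 e3
  rw [rh_rh_rh hx] at e3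
  unfold hh
  rw [← tst2 ((p : ℤ) * q - nu (sg x)) (nu x - (p : ℤ) * q) (nu (rh x) - (p : ℤ) * q), e1, e2, e3]
  congr! 3 <;> ring_nf

theorem hh_dvd {nu} (hnu : IsNu p q nu) (hc : Nat.Coprime p q) {x : ZMod p × ZMod q}
    (h1 : x.1 ≠ 0) (h2 : x.2 ≠ 0) : (p : ℤ) * q ∣ hh p q nu x 0 1 := by
  unfold hh
  rw [tst_e01]
  obtain ⟨a1, a2, a3, a4⟩ := hnu x
  obtain ⟨b1, b2, b3, b4⟩ := hnu (sg x)
  apply IsCoprime.mul_dvd (Nat.isCoprime_iff_coprime.2 hc)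
  · rw [← ZMod.intCast_zmod_eq_zero_iff_dvd]; push_cast; rw [a3, b3]; simp [sg, h1]
  · rw [← ZMod.intCast_zmod_eq_zero_iff_dvd]; push_cast; rw [a4, b4]; simp [sg, h2]

theorem uu_two {nu} (hnu : IsNu p q nu) (hc : Nat.Coprime p q) {t : ℕ} (ht : 2 ≤ t)
    (ht2 : t ≤ q - 2) :
    nu (uu p q t) = nu (sg (uu p q (t + 1))) + 2 := by
  have hq2 := (Fact.out : q.Prime).two_le
  have c1 : (t : ZMod q) ≠ 0 ∧ (t : ZMod q) ≠ -1 := cast_ne (by omega) ht2 hq2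
  have c2 : (t : ZMod q) + 1 ≠ 0 := fun h => c1.2 (by linear_combination h)
  have hs : sg (uu p q (t + 1)) = (-1, -1 - (t : ZMod q)⁻¹) := by
    unfold sg uu
    ext
    · simp
    · have h0 := c1.1
      have : (1 : ZMod q) - ((t : ZMod q) + 1)⁻¹ = t / (t + 1) := by field_simp; ring
      push_cast
      simp only [this, inv_div]
      field_simp
      ring
  rw [hs]
  have e1 := nu_succ hnu hc (x := ((-1, -1 - (t : ZMod q)⁻¹) : ZMod p × ZMod q)) (by simp)
  have e2 := nu_succ hnu hc (x := ((-1 + 1, -1 - (t : ZMod q)⁻¹ + 1) : ZMod p × ZMod q)) (by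
    rintro ⟨-, h⟩
    have h' : (t : ZMod q)⁻¹ = 0 := by linear_combination -h
    rw [inv_eq_zero] at h'
    exact c1.1 h')
  have e3 : uu p q t = (-1 + 1 + 1, -1 - (t : ZMod q)⁻¹ + 1 + 1) := by
    unfold uu; ext <;> simp; ring
  rw [e3, e2, e1]; ring

theorem uu_ne {t : ℕ} (ht : 2 ≤ t) (ht2 : t ≤ q - 1) : (uu p q t).1 ≠ 0 ∧ (uu p q t).2 ≠ 0 := by
  refine ⟨by simp [uu], ?_⟩
  intro h
  have h1 : (t : ZMod q) = 1 := by
    unfold uu at h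
    have : (t : ZMod q)⁻¹ = 1 := by linear_combination -h
    rwa [inv_eq_one] at this
  have : ((t - 1 : ℕ) : ZMod q) = 0 := by
    rw [Nat.cast_sub (by omega)]; simp [h1]
  rw [ZMod.natCast_eq_zero_iff] at this
  have := Nat.le_of_dvd (by omega) this
  have hq2 := (Fact.out : q.Prime).two_le
  omega

theorem hh_uu {nu} (hnu : IsNu p q nu) (hc : Nat.Coprime p q) {t : ℕ} (ht : 2 ≤ t)
    (ht2 : t ≤ q - 2) :
    hh p q nu (uu p q t) * hh p q nu (uu p q (t + 1)) =
      T ^ ((p : ℤ) * q - nu (sg (uu p q t))) * S * T ^ (2 : ℤ) * S *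
        T ^ (nu (uu p q (t + 1)) - (p : ℤ) * q) := by
  unfold hh
  apply tst3
  rw [uu_two hnu hc ht ht2]; ring

/-- entry bounds -/
structure Bd (g : SL2Z) (c : ℤ) : Prop where
  c2 : 2 ≤ c
  e10 : g 1 0 = c
  a1 : 1 ≤ g 0 0
  a2 : g 0 0 ≤ c - 1
  d1 : -(c - 1) ≤ g 1 1
  d2 : g 1 1 ≤ -1

theorem Bd.tr {g : SL2Z} {c : ℤ} (h : Bd g c) : |g 0 0 + g 1 1| ≤ c - 2 := by
  obtain ⟨h0, h1, h2, h3, h4, h5⟩ := h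
  rw [abs_le]; constructor <;> linarith

theorem Bd.fro {g : SL2Z} {c : ℤ} (h : Bd g c) :
    Real.sqrt ((g 0 0 : ℝ) ^ 2 + (g 0 1 : ℝ) ^ 2 + (g 1 0 : ℝ) ^ 2 + (g 1 1 : ℝ) ^ 2)
      < 2 * (c : ℝ) - 1 := by
  obtain ⟨h0, h1, h2, h3, h4, h5⟩ := h
  have hd := sl_det g
  rw [h1] at hd ⊢
  generalize g 0 0 = a at *
  generalize g 0 1 = b at *
  generalize g 1 1 = d at *
  have hb1 : -(c - 1) ≤ b := by
    by_contra hlt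
    have : b ≤ -c := by omega
    nlinarith
  have hb2 : b ≤ -1 := by
    by_contra hlt
    have : 0 ≤ b := by omega
    nlinarith
  have key : a ^ 2 + b ^ 2 + c ^ 2 + d ^ 2 < (2 * c - 1) ^ 2 := by nlinarith
  have h0' : (2 : ℝ) ≤ c := by exact_mod_cast h0
  rw [Real.sqrt_lt' (by linarith)]
  exact_mod_cast key

end Nu
section Scale

open ModularGroup

/-- pairs `(γ, δ)` with `δ = D γ D⁻¹`, `D = diag (n, 1)` -/
def Sc (n : ℤ) : Subgroup (SL2Z × SL2Z) where
  carrier := {x | x.1 0 0 = x.2 0 0 ∧ n * x.1 0 1 = x.2 0 1 ∧ x.1 1 0 = n * x.2 1 0 ∧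
    x.1 1 1 = x.2 1 1}
  mul_mem' := by
    rintro ⟨a, b⟩ ⟨c, d⟩ ⟨h1, h2, h3, h4⟩ ⟨k1, k2, k3, k4⟩
    simp only [Set.mem_ofPred_eq, Prod.mk_mul_mk, e00, e01, e10, e11] at *
    rw [← h1, ← h2, h3, ← h4, ← k1, ← k2, k3, ← k4]
    refine ⟨by ring, by ring, by ring, by ring⟩
  one_mem' := by simp
  inv_mem' := by
    rintro ⟨a, b⟩ ⟨h1, h2, h3, h4⟩
    simp only [Set.mem_ofPred_eq, Prod.inv_mk, Matrix.SpecialLinearGroup.SL2_inv_expl] at *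
    simp [← h1, ← h2, h3, ← h4]

theorem mem_Sc {n : ℤ} {a b : SL2Z} : (a, b) ∈ Sc n ↔ a 0 0 = b 0 0 ∧ n * a 0 1 = b 0 1 ∧
    a 1 0 = n * b 1 0 ∧ a 1 1 = b 1 1 := Iff.rfl

theorem Sc_mul {n : ℤ} {a b c d : SL2Z} (h : (a, b) ∈ Sc n) (h' : (c, d) ∈ Sc n) :
    (a * c, b * d) ∈ Sc n := (Sc n).mul_mem h h'

theorem Sc_inv {n : ℤ} {a b : SL2Z} (h : (a, b) ∈ Sc n) : (a⁻¹, b⁻¹) ∈ Sc n := by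
  rw [← Prod.inv_mk]; exact inv_mem h

theorem Sc_one {n : ℤ} : ((1 : SL2Z), (1 : SL2Z)) ∈ Sc n := (Sc n).one_mem

theorem exists_up {n : ℤ} {δ : SL2Z} (h : n ∣ δ 0 1) : ∃ γ, (γ, δ) ∈ Sc n := by
  obtain ⟨c, hc⟩ := h
  have hd : Matrix.det !![δ 0 0, c; n * δ 1 0, δ 1 1] = 1 := by
    rw [Matrix.det_fin_two_of]
    have := sl_det δ
    rw [hc] at this
    linear_combination this
  exact ⟨⟨_, hd⟩, rfl, hc.symm, rfl, rfl⟩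

theorem exists_down {n : ℤ} {γ : SL2Z} (h : n ∣ γ 1 0) : ∃ δ, (γ, δ) ∈ Sc n := by
  obtain ⟨c, hc⟩ := h
  have hd : Matrix.det !![γ 0 0, n * γ 0 1; c, γ 1 1] = 1 := by
    rw [Matrix.det_fin_two_of]
    have := sl_det γ
    rw [hc] at this
    linear_combination this
  exact ⟨⟨_, hd⟩, rfl, rfl, hc, rfl⟩

theorem Sc_left {n : ℤ} (hn : n ≠ 0) {a b d : SL2Z} (h : (a, d) ∈ Sc n) (h' : (b, d) ∈ Sc n) :
    a = b := by
  rw [mem_Sc] at h h'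
  apply sl_ext
  · rw [h.1, h'.1]
  · apply mul_left_cancel₀ hn; rw [h.2.1, h'.2.1]
  · rw [h.2.2.1, h'.2.2.1]
  · rw [h.2.2.2, h'.2.2.2]

theorem Sc_right {n : ℤ} (hn : n ≠ 0) {a b d : SL2Z} (h : (d, a) ∈ Sc n) (h' : (d, b) ∈ Sc n) :
    a = b := by
  rw [mem_Sc] at h h'
  apply sl_ext
  · rw [← h.1, ← h'.1]
  · rw [← h.2.1, ← h'.2.1]
  · apply mul_left_cancel₀ hn; rw [← h.2.2.1, ← h'.2.2.1]
  · rw [← h.2.2.2, ← h'.2.2.2]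

theorem Sc_neg_one (n : ℤ) : ((-1 : SL2Z), (-1 : SL2Z)) ∈ Sc n := by
  rw [mem_Sc]; simp

theorem Sc_T (n : ℤ) : (T, T ^ n) ∈ Sc n := by
  rw [mem_Sc, T00, T01, T10, T11, T00', T01', T10', T11']; simp

open Classical in
/-- a chosen conjugate -/
noncomputable def up (n : ℤ) (δ : SL2Z) : SL2Z :=
  if h : n ∣ δ 0 1 then Classical.choose (exists_up h) else 1

theorem up_mem {n : ℤ} {δ : SL2Z} (h : n ∣ δ 0 1) : (up n δ, δ) ∈ Sc n := by
  unfold up; rw [dif_pos h]; exact Classical.choose_spec (exists_up h)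

theorem up_Bd {n : ℤ} {δ : SL2Z} {c : ℤ} (h : n ∣ δ 0 1) (hc : 2 ≤ c) (h1 : n * δ 1 0 = c)
    (h2 : 1 ≤ δ 0 0) (h3 : δ 0 0 ≤ c - 1) (h4 : -(c - 1) ≤ δ 1 1) (h5 : δ 1 1 ≤ -1) :
    Bd (up n δ) c := by
  obtain ⟨a1, a2, a3, a4⟩ := up_mem h
  exact ⟨hc, by rw [← h1]; exact a3, by rw [show up n δ 0 0 = δ 0 0 from a1]; exact h2,
    by rw [show up n δ 0 0 = δ 0 0 from a1]; exact h3,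
    by rw [show up n δ 1 1 = δ 1 1 from a4]; exact h4,
    by rw [show up n δ 1 1 = δ 1 1 from a4]; exact h5⟩

theorem Sc_dvd {n : ℤ} {a b : SL2Z} (h : (a, b) ∈ Sc n) : n ∣ b 0 1 := ⟨_, h.2.1.symm⟩

end Scale

section Eval

open ModularGroup

variable {p q : ℕ} [Fact p.Prime] [Fact q.Prime] {F : Type} [Group F]

/-- integer points -/
def zz (p q : ℕ) (j : ℤ) : XX p q := (some (j : ZMod p), some (j : ZMod q))

theorem zz_congr {i j : ℤ} (h : (p : ℤ) * q ∣ i - j) : zz p q i = zz p q j := by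
  unfold zz
  have h1 : (p : ℤ) ∣ i - j := (Dvd.intro _ rfl).trans h
  have h2 : (q : ℤ) ∣ i - j := (Dvd.intro_left _ rfl).trans h
  rw [← ZMod.intCast_zmod_eq_zero_iff_dvd] at h1 h2
  push_cast at h1 h2
  rw [sub_eq_zero.1 h1, sub_eq_zero.1 h2]

variable {f : ZMod p × ZMod q → F} {hf : ∀ x, f (sg x) * f x = 1} {t k : F}
  {Θ : SL2Z →* Equiv.Perm (XX p q × F)}

theorem ev_T1 (hc : Nat.Coprime p q) (hT : Θ T = permT f t k) {j : ℤ} (hj : ¬ (p : ℤ) * q ∣ j)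
    (w : F) : Θ T (zz p q j, w) = (zz p q (j + 1), w) := by
  rw [hT]
  change ((_, _), cT f t k (zz p q j) * w) = _
  have : cT f t k (zz p q j) = 1 := by
    change (if (j : ZMod p) = 0 ∧ (j : ZMod q) = 0 then t else 1) = 1
    rw [if_neg]
    rintro ⟨h1, h2⟩
    rw [ZMod.intCast_zmod_eq_zero_iff_dvd] at h1 h2
    exact hj (IsCoprime.mul_dvd (Nat.isCoprime_iff_coprime.2 hc) h1 h2)
  rw [this, one_mul]
  simp [zz, oT]

theorem ev_T0 (hT : Θ T = permT f t k) (w : F) :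
    Θ T (zz p q 0, w) = (zz p q 1, t * w) := by
  rw [hT]
  change ((_, _), cT f t k (zz p q 0) * w) = _
  have : cT f t k (zz p q 0) = t := by
    simp [zz, cT]
  rw [this]
  simp [zz, oT]

theorem ev_up (hc : Nat.Coprime p q) (hT : Θ T = permT f t k) (i : ℕ) (hi : (i : ℤ) < (p : ℤ) * q)
    (w : F) : Θ (T ^ (i : ℤ)) (zz p q (-i), w) = (zz p q 0, w) := by
  induction i with
  | zero => simp
  | succ i ih =>
    have : T ^ ((i + 1 : ℕ) : ℤ) = T ^ (i : ℤ) * T := by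
      rw [Nat.cast_succ, _root_.zpow_add, zpow_one]
    rw [this, map_mul, Equiv.Perm.mul_apply, ev_T1 hc hT]
    · have h2 : -((i + 1 : ℕ) : ℤ) + 1 = -i := by push_cast; ring
      rw [h2, ih (by push_cast at hi; linarith)]
    · intro h
      rw [dvd_neg] at h
      have := Int.le_of_dvd (by positivity) h
      linarith

theorem ev_up' (hc : Nat.Coprime p q) (hT : Θ T = permT f t k) (i : ℤ) (h0 : 0 ≤ i)
    (hi : i < (p : ℤ) * q) (w : F) : Θ (T ^ i) (zz p q (-i), w) = (zz p q 0, w) := by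
  lift i to ℕ using h0
  exact ev_up hc hT i hi w

theorem ev_dn (hc : Nat.Coprime p q) (hT : Θ T = permT f t k) (i : ℤ) (h0 : 0 ≤ i)
    (hi : i < (p : ℤ) * q) (w : F) : Θ (T ^ (-i)) (zz p q 0, w) = (zz p q (-i), w) := by
  rw [← ev_up' hc hT i h0 hi w, ← Equiv.Perm.mul_apply, ← map_mul, ← _root_.zpow_add]
  simp

theorem ev_Tn (hc : Nat.Coprime p q) (hT : Θ T = permT f t k) (w : F) :
    Θ (T ^ ((p : ℤ) * q)) (zz p q 0, w) = (zz p q 0, t * w) := by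
  have hp0 : (0 : ℤ) < p := by exact_mod_cast (Fact.out : p.Prime).pos
  have hq0 : (0 : ℤ) < q := by exact_mod_cast (Fact.out : q.Prime).pos
  have hn : (0 : ℤ) < (p : ℤ) * q := mul_pos hp0 hq0
  have : T ^ ((p : ℤ) * q) = T ^ ((p : ℤ) * q - 1) * T := by
    rw [_root_.zpow_sub_one, inv_mul_cancel_right]
  rw [this, map_mul, Equiv.Perm.mul_apply, ev_T0 hT]
  have h1 : zz p q 1 = zz p q (-((p : ℤ) * q - 1)) := zz_congr ⟨1, by ring⟩
  rw [h1, ev_up' hc hT _ (by linarith) (by linarith)]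

theorem ev_hh {nu} (hnu : IsNu p q nu) (hc : Nat.Coprime p q) (hS : Θ S = permS f hf)
    (hT : Θ T = permT f t k) {x : ZMod p × ZMod q} (h1 : x.1 ≠ 0) (h2 : x.2 ≠ 0) (w : F) :
    Θ (hh p q nu x) (zz p q 0, w) = (zz p q 0, f x * w) := by
  unfold hh
  have b1 := nu_lt hnu (x := x) (fun h => h1 h.1)
  have b2 := nu_lt hnu (x := sg x) (fun h => by simp [sg, h1] at h)
  obtain ⟨a1, a2, a3, a4⟩ := hnu x
  obtain ⟨c1, c2, c3, c4⟩ := hnu (sg x)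
  rw [map_mul, map_mul, Equiv.Perm.mul_apply, Equiv.Perm.mul_apply]
  rw [show nu x - (p : ℤ) * q = -((p : ℤ) * q - nu x) by ring,
    ev_dn hc hT _ (by linarith) (by linarith)]
  have z1 : zz p q (-((p : ℤ) * q - nu x)) = (some x.1, some x.2) := by
    unfold zz; push_cast; rw [a3, a4]; simp
  have z2 : zz p q (-((p : ℤ) * q - nu (sg x))) = (some (-x.1⁻¹), some (-x.2⁻¹)) := by
    unfold zz; push_cast; rw [c3, c4]; simp [sg]
  have : Θ S (zz p q (-((p : ℤ) * q - nu x)), w) = (zz p q (-((p : ℤ) * q - nu (sg x))), f x * w) := by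
    rw [z1, z2, hS]
    change ((oS (some x.1), oS (some x.2)), cS f (some x.1, some x.2) * w) = _
    simp [oS, cS, h1, h2]
  rw [this, ev_up' hc hT _ (by linarith) (by linarith)]

theorem ev_ke (hc : Nat.Coprime p q) (hS : Θ S = permS f hf) (hT : Θ T = permT f t k) {e : ℤ}
    (he0 : 1 ≤ e) (he1 : e < (p : ℤ) * q) (hep : (e : ZMod p) = 0) (heq : (e : ZMod q) = 1) (w : F) :
    Θ (T ^ e * S * T ^ (2 : ℤ) * S * T ^ (e - (p : ℤ) * q)) (zz p q 0, w) = (zz p q 0, k * w) := by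
  rw [show T ^ e * S * T ^ (2 : ℤ) * S * T ^ (e - (p : ℤ) * q) =
    T ^ e * (S * (T * (T * (S * T ^ (-((p : ℤ) * q - e)))))) by
      rw [_root_.zpow_two, neg_sub]; simp only [mul_assoc]]
  simp only [map_mul, Equiv.Perm.mul_apply]
  rw [ev_dn hc hT _ (by linarith) (by linarith)]
  have z1 : zz p q (-((p : ℤ) * q - e)) = (some 0, some 1) := by
    unfold zz; push_cast; rw [hep, heq]; simp
  have z2 : zz p q (-e) = (some 0, some (-1)) := by
    unfold zz; push_cast; rw [hep, heq]; simp
  have s1 : Θ S ((some 0, some 1), w) = ((none, some (-1)), w) := by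
    rw [hS]
    change ((oS (some 0), oS (some 1)), cS f (some 0, some 1) * w) = _
    simp [oS, cS]
  have s2 : Θ T ((none, some (-1)), w) = ((none, some 0), k * w) := by
    rw [hT]
    change ((oT none, oT (some (-1))), cT f t k (none, some (-1)) * w) = _
    simp [oT, cT]
  have s3 : Θ T ((none, some 0), k * w) = ((none, some 1), k * w) := by
    rw [hT]
    change ((oT none, oT (some 0)), cT f t k (none, some 0) * (k * w)) = _
    simp [oT, cT]
  have s4 : Θ S ((none, some 1), k * w) = ((some 0, some (-1)), k * w) := by
    rw [hS]
    change ((oS none, oS (some 1)), cS f (none, some 1) * (k * w)) = _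
    simp [oS, cS]
  rw [z1, s1, s2, s3, s4, ← z2, ev_up' hc hT _ (by linarith) (by linarith)]

end Eval
section Main

open ModularGroup

variable {p q : ℕ} [Fact p.Prime] [Fact q.Prime]

/-- the exceptional element -/
def ke (p q : ℕ) (e : ℤ) : SL2Z := T ^ e * S * T ^ (2 : ℤ) * S * T ^ (e - (p : ℤ) * q)

/-- representatives of the free darts -/
def RepD (B : Set (ZMod p × ZMod q)) (nu : ZMod p × ZMod q → ℤ) : Set (ZMod p × ZMod q) :=
  {x | x ∈ B ∧ x.1 ≠ 0 ∧ x.2 ≠ 0 ∧ nu x ≤ nu (sg x)}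

theorem sg_ne {x : ZMod p × ZMod q} (h : x.1 ≠ 0 ∧ x.2 ≠ 0) : (sg x).1 ≠ 0 ∧ (sg x).2 ≠ 0 := by
  simp [sg, h.1, h.2]

theorem sg_ne_iff {x : ZMod p × ZMod q} :
    ((sg x).1 ≠ 0 ∧ (sg x).2 ≠ 0) ↔ (x.1 ≠ 0 ∧ x.2 ≠ 0) := by
  simp [sg]

theorem up_sg {nu} (hnu : IsNu p q nu) (hc : Nat.Coprime p q) (hn : (p : ℤ) * q ≠ 0)
    {x : ZMod p × ZMod q} (hx : x.1 ≠ 0 ∧ x.2 ≠ 0) :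
    projPSL (up (p * q) (hh p q nu (sg x))) * projPSL (up (p * q) (hh p q nu x)) = 1 := by
  have h1 := up_mem (hh_dvd hnu hc hx.1 hx.2)
  have h2 := up_mem (hh_dvd hnu hc (sg_ne hx).1 (sg_ne hx).2)
  have h3 := Sc_mul h2 h1
  rw [hh_sg] at h3
  rw [← map_mul, Sc_left hn h3 (Sc_neg_one _), proj_neg, map_one]

theorem up_rh {nu} (hnu : IsNu p q nu) (hc : Nat.Coprime p q) (hn : (p : ℤ) * q ≠ 0)
    {x : ZMod p × ZMod q} (hx : x ∈ AA p q) :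
    projPSL (up (p * q) (hh p q nu x)) * projPSL (up (p * q) (hh p q nu (rh x))) *
      projPSL (up (p * q) (hh p q nu (rh (rh x)))) = 1 := by
  have hx2 := rh_mem hx
  have hx3 := rh_mem hx2
  have h1 := up_mem (hh_dvd hnu hc hx.1 hx.2.2.1)
  have h2 := up_mem (hh_dvd hnu hc hx2.1 hx2.2.2.1)
  have h3 := up_mem (hh_dvd hnu hc hx3.1 hx3.2.2.1)
  have h4 := Sc_mul (Sc_mul h1 h2) h3
  rw [hh_rh hnu hc hx] at h4
  rw [← map_mul, ← map_mul, Sc_left hn h4 Sc_one, map_one]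

theorem uu_dvd {nu} (hnu : IsNu p q nu) (hc : Nat.Coprime p q) {t : ℕ} (ht : 2 ≤ t)
    (ht2 : t ≤ q - 2) :
    (up (p * q) (hh p q nu (uu p q t)) * up (p * q) (hh p q nu (uu p q (t + 1))),
      hh p q nu (uu p q t) * hh p q nu (uu p q (t + 1))) ∈ Sc ((p : ℤ) * q) := by
  have hq2 := (Fact.out : q.Prime).two_le
  have a := uu_ne (p := p) (q := q) ht (by omega)
  have b := uu_ne (p := p) (q := q) (t := t + 1) (by omega) (by omega)
  exact Sc_mul (up_mem (hh_dvd hnu hc a.1 a.2)) (up_mem (hh_dvd hnu hc b.1 b.2))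

theorem ke_dvd (hc : Nat.Coprime p q) {e : ℤ} (hep : (e : ZMod p) = 0) (heq : (e : ZMod q) = 1) :
    (p : ℤ) * q ∣ ke p q e 0 1 := by
  unfold ke
  rw [ttt_e01]
  have h1 : (p : ℤ) ∣ e := (ZMod.intCast_zmod_eq_zero_iff_dvd _ _).1 hep
  have h2 : (q : ℤ) ∣ e - 1 := by
    rw [← ZMod.intCast_zmod_eq_zero_iff_dvd]; push_cast; rw [heq]; simp
  obtain ⟨a, ha⟩ := h1
  obtain ⟨b, hb⟩ := h2
  refine ⟨2 * a * b - (2 * e - 1), ?_⟩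
  linear_combination 2 * (e - 1) * ha + 2 * (p : ℤ) * a * hb

theorem main_abs {m : ℕ} {J : Finset ℕ} {B : Set (ZMod p × ZMod q)} (hB : CombGood p q m J B)
    (hc : Nat.Coprime p q) {nu} (hnu : IsNu p q nu) {e : ℤ}
    (he0 : 1 ≤ e) (he1 : e < (p : ℤ) * q) (hep : (e : ZMod p) = 0) (heq : (e : ZMod q) = 1)
    {F : Type} [Group F] (φ : F →* PSL2Z) (ER : ZMod p × ZMod q → F) (E1 : ℕ → F) (Ek TF : F)
    (hER : ∀ x ∈ RepD B nu, φ (ER x) = projPSL (up (p * q) (hh p q nu x)))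
    (hE1 : ∀ t ∈ J, φ (E1 t) =
      projPSL (up (p * q) (hh p q nu (uu p q t) * hh p q nu (uu p q (t + 1)))))
    (hEk : φ Ek = projPSL (up (p * q) (ke p q e)))
    (hTF : φ TF = projPSL T)
    (hgen : ∀ K : Subgroup F, (∀ x ∈ RepD B nu, ER x ∈ K) → (∀ t ∈ J, E1 t ∈ K) → Ek ∈ K → TF ∈ K →
      ∀ w, w ∈ K)
    (htor : ∀ x ∈ RepD B nu, ∀ k : ℕ, φ (ER x) ^ k = 1 → ER x ^ k = 1) :
    Function.Injective φ ∧ ∀ γ : SL2Z, projPSL γ ∈ φ.range ↔ (p : ℤ) * q ∣ γ 1 0 := by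
  classical
  have hp0 : (0 : ℤ) < p := by exact_mod_cast (Fact.out : p.Prime).pos
  have hq0 : (0 : ℤ) < q := by exact_mod_cast (Fact.out : q.Prime).pos
  have hn : (p : ℤ) * q ≠ 0 := (mul_pos hp0 hq0).ne'
  let g : ZMod p × ZMod q → F := fun x =>
    if x ∈ RepD B nu then ER x else if sg x ∈ RepD B nu then (ER (sg x))⁻¹ else 1
  have g1 : ∀ x ∈ RepD B nu, g x = ER x := fun x hx => if_pos hx
  have g2 : ∀ x, x ∉ RepD B nu → sg x ∈ RepD B nu → g x = (ER (sg x))⁻¹ := fun x hx hx2 => by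
    simp only [g]; rw [if_neg hx, if_pos hx2]
  have g3 : ∀ x, x ∉ RepD B nu → sg x ∉ RepD B nu → g x = 1 := fun x hx hx2 => by
    simp only [g]; rw [if_neg hx, if_neg hx2]
  have hgs : ∀ x, g (sg x) * g x = 1 := by
    intro x
    by_cases hx : x ∈ RepD B nu
    · by_cases hx2 : sg x ∈ RepD B nu
      · have hle := hx.2.2.2
        have hge := hx2.2.2.2
        rw [sg_sg] at hge
        have heq2 : nu x = nu (sg x) := le_antisymm hle hge
        have hxx : sg x = x := by
          obtain ⟨-, -, a3, a4⟩ := hnu x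
          obtain ⟨-, -, b3, b4⟩ := hnu (sg x)
          rw [← heq2] at b3 b4
          exact Prod.ext (b3.symm.trans a3) (b4.symm.trans a4)
        rw [hxx, g1 x hx]
        have h1 := up_sg hnu hc hn ⟨hx.2.1, hx.2.2.1⟩
        rw [hxx, ← hER x hx, ← sq] at h1
        rw [← sq]; exact htor x hx 2 h1
      · rw [g1 x hx, g2 (sg x) hx2 (by rwa [sg_sg]), sg_sg]; simp
    · by_cases hx2 : sg x ∈ RepD B nu
      · rw [g1 _ hx2, g2 x hx hx2]; simp
      · rw [g3 x hx hx2, g3 (sg x) hx2 (by rwa [sg_sg])]; simp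
  have hgr : ∀ x ∈ AA p q, rh x = x → g x * g x * g x = 1 := by
    intro x hxA hxr
    have h3 := up_rh hnu hc hn hxA
    rw [hxr, hxr] at h3
    by_cases hx : x ∈ RepD B nu
    · rw [g1 x hx]
      have := htor x hx 3 (by rw [hER x hx, pow_three', h3])
      rwa [pow_three'] at this
    by_cases hx2 : sg x ∈ RepD B nu
    · rw [g2 x hx hx2]
      have h1 := up_sg hnu hc hn ⟨hxA.1, hxA.2.2.1⟩
      rw [mul_eq_one_iff_eq_inv] at h1
      have := htor _ hx2 3 (by
        rw [hER _ hx2, h1, inv_pow, pow_three', h3, inv_one])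
      have h4 : (ER (sg x))⁻¹ ^ 3 = 1 := by rw [inv_pow, this, inv_one]
      rwa [pow_three'] at h4
    · rw [g3 x hx hx2]; simp
  obtain ⟨f, hf, hr, hfB, hfJ⟩ := hB.ext F g E1 hgs hgr
  obtain ⟨Θ, hS, hT, hneg⟩ := cocycle_hom hf hr TF Ek
  -- the comparison subgroup
  let W : Subgroup F :=
    { carrier := {w | ∃ γ δ : SL2Z, (γ, δ) ∈ Sc ((p : ℤ) * q) ∧ projPSL γ = φ w ∧
        ∀ w', Θ δ (zz p q 0, w') = (zz p q 0, w * w')}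
      mul_mem' := by
        rintro a b ⟨γ, δ, h1, h2, h3⟩ ⟨γ', δ', h1', h2', h3'⟩
        refine ⟨γ * γ', δ * δ', Sc_mul h1 h1', by rw [map_mul, map_mul, h2, h2'], ?_⟩
        intro w'
        rw [map_mul, Equiv.Perm.mul_apply, h3', h3, mul_assoc]
      one_mem' := ⟨1, 1, Sc_one, by simp, by simp⟩
      inv_mem' := by
        rintro a ⟨γ, δ, h1, h2, h3⟩
        refine ⟨γ⁻¹, δ⁻¹, Sc_inv h1, by rw [map_inv, map_inv, h2], ?_⟩
        intro w'
        rw [map_inv, Equiv.Perm.inv_eq_iff_eq, h3]; simp }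
  have hW : ∀ w, w ∈ W := by
    apply hgen W
    · intro x hx
      refine ⟨_, _, up_mem (hh_dvd hnu hc hx.2.1 hx.2.2.1), (hER x hx).symm, ?_⟩
      intro w'
      rw [ev_hh hnu hc hS hT hx.2.1 hx.2.2.1, hfB x hx.1, g1 x hx]
    · intro t ht
      obtain ⟨t1, t2⟩ := hB.sub t ht
      have hq2 := (Fact.out : q.Prime).two_le
      have a := uu_ne (p := p) (q := q) t1 (by omega)
      have b := uu_ne (p := p) (q := q) (t := t + 1) (by omega) (by omega)
      refine ⟨_, _, up_mem (Sc_dvd (uu_dvd hnu hc t1 t2)), (hE1 t ht).symm, ?_⟩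
      intro w'
      rw [map_mul, Equiv.Perm.mul_apply, ev_hh hnu hc hS hT b.1 b.2, ev_hh hnu hc hS hT a.1 a.2,
        ← mul_assoc, hfJ t ht]
    · refine ⟨_, _, up_mem (ke_dvd hc hep heq), hEk.symm, ?_⟩
      intro w'
      exact ev_ke hc hS hT he0 he1 hep heq w'
    · exact ⟨_, _, Sc_T _, hTF.symm, fun w' => ev_Tn hc hT w'⟩
  refine ⟨?_, ?_⟩
  · rw [injective_iff_map_eq_one]
    intro w hw
    obtain ⟨γ, δ, h1, h2, h3⟩ := hW w
    rw [hw, ← map_one projPSL, proj_eq_iff] at h2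
    have hδ : Θ δ = 1 := by
      rcases h2 with h2 | h2
      · rw [← h2] at h1
        rw [Sc_right hn h1 Sc_one, map_one]
      · have : γ = -1 := by rw [h2]; simp
        rw [this] at h1
        rw [Sc_right hn h1 (Sc_neg_one _), hneg]
    have := h3 1
    rw [hδ] at this
    simpa using (congrArg Prod.snd this).symm
  · intro γ
    constructor
    · rintro ⟨w, hw⟩
      obtain ⟨γ', δ, h1, h2, h3⟩ := hW w
      rw [hw, proj_eq_iff] at h2
      have h4 : (p : ℤ) * q ∣ γ' 1 0 := ⟨_, h1.2.2.1⟩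
      rcases h2 with rfl | rfl
      · exact h4
      · rw [neg_e, dvd_neg]; exact h4
    · intro hγ
      obtain ⟨δ, hδ⟩ := exists_down hγ
      let L : Subgroup SL2Z := ((Sc ((p : ℤ) * q)) ⊓
        (φ.range.comap (projPSL.comp (MonoidHom.fst SL2Z SL2Z)))).map (MonoidHom.snd SL2Z SL2Z)
      have mL : ∀ a b : SL2Z, (a, b) ∈ Sc ((p : ℤ) * q) → projPSL a ∈ φ.range → b ∈ L :=
        fun a b h1 h2 => ⟨(a, b), ⟨h1, h2⟩, rfl⟩
      have mL' : ∀ b ∈ L, ∃ a, (a, b) ∈ Sc ((p : ℤ) * q) ∧ projPSL a ∈ φ.range := by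
        rintro b ⟨⟨a, b'⟩, ⟨h1, h2⟩, rfl⟩
        exact ⟨a, h1, h2⟩
      have hTn : T ^ ((p : ℤ) * q) ∈ L := mL _ _ (Sc_T _) ⟨TF, hTF⟩
      have hTm : ∀ i : ℤ, (p : ℤ) * q ∣ i → T ^ i ∈ L := by
        rintro i ⟨c, rfl⟩
        rw [_root_.zpow_mul]; exact zpow_mem hTn c
      have hunits : ∀ x : ZMod p × ZMod q, x.1 ≠ 0 ∧ x.2 ≠ 0 → hh p q nu x ∈ L := by
        let f' : ZMod p × ZMod q → PSL2Z := fun x =>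
          if x.1 ≠ 0 ∧ x.2 ≠ 0 then projPSL (up (p * q) (hh p q nu x)) else 1
        have f1 : ∀ x : ZMod p × ZMod q, x.1 ≠ 0 ∧ x.2 ≠ 0 →
          f' x = projPSL (up (p * q) (hh p q nu x)) := fun x hx => if_pos hx
        have f2 : ∀ x : ZMod p × ZMod q, ¬ (x.1 ≠ 0 ∧ x.2 ≠ 0) → f' x = 1 := fun x hx => if_neg hx
        have hfs : ∀ x, f' (sg x) * f' x = 1 := by
          intro x
          by_cases hx : x.1 ≠ 0 ∧ x.2 ≠ 0
          · rw [f1 x hx, f1 _ (sg_ne hx)]; exact up_sg hnu hc hn hx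
          · rw [f2 x hx, f2 (sg x) (by rwa [sg_ne_iff])]; simp
        have key := hB.gen PSL2Z f' hfs (by
          intro x hx
          have hx2 := rh_mem hx
          have hx3 := rh_mem hx2
          rw [f1 x ⟨hx.1, hx.2.2.1⟩, f1 _ ⟨hx2.1, hx2.2.2.1⟩, f1 _ ⟨hx3.1, hx3.2.2.1⟩]
          exact up_rh hnu hc hn hx) φ.range (by
          intro x hxB
          by_cases hx : x.1 ≠ 0 ∧ x.2 ≠ 0
          · rcases le_total (nu x) (nu (sg x)) with h | h
            · have hR : x ∈ RepD B nu := ⟨hxB, hx.1, hx.2, h⟩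
              rw [f1 x hx, ← hER x hR]; exact ⟨_, rfl⟩
            · have hR : sg x ∈ RepD B nu :=
                ⟨hB.symm x hxB, (sg_ne hx).1, (sg_ne hx).2, by rwa [sg_sg]⟩
              have h1 := hfs x
              rw [mul_eq_one_iff_inv_eq] at h1
              rw [← h1, f1 _ (sg_ne hx), ← hER _ hR]
              exact inv_mem ⟨_, rfl⟩
          · rw [f2 x hx]; exact one_mem _) (by
          intro t ht
          obtain ⟨t1, t2⟩ := hB.sub t ht
          have hq2 := (Fact.out : q.Prime).two_le
          have a := uu_ne (p := p) (q := q) t1 (by omega)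
          have b := uu_ne (p := p) (q := q) (t := t + 1) (by omega) (by omega)
          rw [f1 _ a, f1 _ b, ← map_mul,
            Sc_left hn (uu_dvd hnu hc t1 t2) (up_mem (Sc_dvd (uu_dvd hnu hc t1 t2))),
            ← hE1 t ht]
          exact ⟨_, rfl⟩)
        intro x hx
        refine mL _ _ (up_mem (hh_dvd hnu hc hx.1 hx.2)) ?_
        rw [← f1 x hx]; exact key x
      have hδL : δ ∈ L := by
        have hcop : IsCoprime (p : ℤ) (q : ℤ) := Nat.isCoprime_iff_coprime.2 hc
        refine cover_all p q (Nat.prime_iff_prime_int.1 Fact.out) (Nat.prime_iff_prime_int.1 Fact.out)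
          hcop L ?_ hTn ?_ e ?_ ?_ ?_ ?_ δ (Sc_dvd hδ)
        · refine mL _ _ (Sc_neg_one _) ?_
          rw [proj_neg, map_one]; exact one_mem _
        · intro j j' hjj
          have hjp : (j : ZMod p) * (j' : ZMod p) = -1 := by
            have := (ZMod.intCast_zmod_eq_zero_iff_dvd _ p).2 ((Dvd.intro _ rfl).trans hjj)
            push_cast at this; linear_combination this
          have hjq : (j : ZMod q) * (j' : ZMod q) = -1 := by
            have := (ZMod.intCast_zmod_eq_zero_iff_dvd _ q).2 ((Dvd.intro_left _ rfl).trans hjj)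
            push_cast at this; linear_combination this
          have n1 : (j : ZMod p) ≠ 0 := fun h => by rw [h] at hjp; simp at hjp
          have n2 : (j : ZMod q) ≠ 0 := fun h => by rw [h] at hjq; simp at hjq
          have hm := hunits (j, j) ⟨n1, n2⟩
          obtain ⟨-, -, a3, a4⟩ := hnu (j, j)
          obtain ⟨-, -, b3, b4⟩ := hnu (sg (j, j))
          have i1 : -((j : ZMod p))⁻¹ = j' := by field_simp; linear_combination -hjp
          have i2 : -((j : ZMod q))⁻¹ = j' := by field_simp; linear_combination -hjq
          simp only [sg, i1, i2] at b3 b4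
          have d1 : (p : ℤ) * q ∣ nu (sg (j, j)) - j' - p * q := by
            apply IsCoprime.mul_dvd hcop
            · rw [← ZMod.intCast_zmod_eq_zero_iff_dvd]; push_cast; simp [sg, i1, i2, b3]
            · rw [← ZMod.intCast_zmod_eq_zero_iff_dvd]; push_cast; simp [sg, i1, i2, b4]
          have d2 : (p : ℤ) * q ∣ j - nu (j, j) + p * q := by
            apply IsCoprime.mul_dvd hcop
            · rw [← ZMod.intCast_zmod_eq_zero_iff_dvd]; push_cast; rw [a3]; simp
            · rw [← ZMod.intCast_zmod_eq_zero_iff_dvd]; push_cast; rw [a4]; simp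
          have := mul_mem (mul_mem (hTm _ d1) hm) (hTm _ d2)
          unfold hh at this
          convert this using 1
          have c0 : ∀ u v n : ℤ, T ^ (-j') * S * T ^ j =
              T ^ (u - j' - n) * (T ^ (n - u) * S * T ^ (v - n)) * T ^ (j - v + n) := by
            intro u v n
            have c1 : -j' = (u - j' - n) + (n - u) := by ring
            have c2 : j = (v - n) + (j - v + n) := by ring
            conv_lhs => rw [c1, c2]
            rw [_root_.zpow_add, _root_.zpow_add]
            simp only [mul_assoc]
          exact c0 _ _ _
        · exact (ZMod.intCast_zmod_eq_zero_iff_dvd _ _).1 hep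
        · rw [← ZMod.intCast_zmod_eq_zero_iff_dvd]; push_cast; rw [heq]; simp
        · exact mL _ _ (up_mem (ke_dvd hc hep heq)) ⟨_, hEk⟩
        · intro d hd
          obtain ⟨a, h1, -⟩ := mL' d hd
          exact Sc_dvd h1
      obtain ⟨a, h1, h2⟩ := mL' δ hδL
      rwa [Sc_left hn hδ h1]

end Main
section Fin

open ModularGroup

theorem coprod_aux {I G : Type} [Group G] (a : I → G) (H : I → Subgroup G)
    (hH : ∀ i, H i = Subgroup.zpowers (a i)) :
    ∃ E : I → Monoid.CoprodI (fun o => H o),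
      (∀ i, Monoid.CoprodI.lift (fun o => (H o).subtype) (E i) = a i) ∧
      (∀ K : Subgroup (Monoid.CoprodI (fun o => H o)), (∀ i, E i ∈ K) → ∀ w, w ∈ K) ∧
      ∀ i (k : ℕ), a i ^ k = 1 → E i ^ k = 1 := by
  obtain rfl : H = fun i => Subgroup.zpowers (a i) := funext hH
  refine ⟨fun i => Monoid.CoprodI.of (M := fun o => Subgroup.zpowers (a o)) (i := i)
    ⟨a i, Subgroup.mem_zpowers _⟩, ?_, ?_, ?_⟩
  · intro i
    rw [Monoid.CoprodI.lift_of]; rfl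
  · intro K hK w
    induction w using Monoid.CoprodI.induction_on with
    | one => exact one_mem _
    | of i x =>
      obtain ⟨x, k, rfl⟩ := x
      have := zpow_mem (hK i) k
      rw [← map_zpow] at this
      exact this
    | mul x y hx hy => exact mul_mem hx hy
  · intro i k hk
    rw [← map_pow]
    have : (⟨a i, Subgroup.mem_zpowers _⟩ : Subgroup.zpowers (a i)) ^ k = 1 :=
      Subtype.ext hk
    rw [this, map_one]

variable {p q : ℕ} [Fact p.Prime] [Fact q.Prime]

/-- the generators, indexed abstractly -/
noncomputable def GG (p q : ℕ) (J : Finset ℕ) (R : Set (ZMod p × ZMod q))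
    (nu : ZMod p × ZMod q → ℤ) (e : ℤ) : Option J ⊕ R → SL2Z
  | Sum.inl none => up (p * q) (ke p q e)
  | Sum.inl (some t) => up (p * q) (hh p q nu (uu p q t) * hh p q nu (uu p q (t + 1)))
  | Sum.inr x => up (p * q) (hh p q nu x)

theorem GG_Bd {m : ℕ} {J : Finset ℕ} {B : Set (ZMod p × ZMod q)} (hB : CombGood p q m J B)
    (hc : Nat.Coprime p q) {nu} (hnu : IsNu p q nu) {e : ℤ}
    (he0 : 1 ≤ e) (he1 : e < (p : ℤ) * q) (hep : (e : ZMod p) = 0) (heq : (e : ZMod q) = 1)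
    (s : Option J ⊕ RepD B nu) :
    Bd (GG p q J (RepD B nu) nu e s) (if s.isLeft then 2 * ((p : ℤ) * q) else p * q) := by
  have hp0 : (2 : ℤ) ≤ p := by exact_mod_cast (Fact.out : p.Prime).two_le
  have hq0 : (2 : ℤ) ≤ q := by exact_mod_cast (Fact.out : q.Prime).two_le
  have hn : (2 : ℤ) ≤ (p : ℤ) * q := by nlinarith
  rcases s with (_ | ⟨t, ht⟩) | ⟨x, hx⟩
  · simp only [Sum.isLeft_inl, if_true]
    apply up_Bd (ke_dvd hc hep heq) <;> (try unfold ke) <;>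
      (try simp only [ttt_e00, ttt_e10, ttt_e11]) <;> linarith
  · simp only [Sum.isLeft_inl, if_true]
    obtain ⟨t1, t2⟩ := hB.sub t ht
    have hq2 := (Fact.out : q.Prime).two_le
    have a := uu_ne (p := p) (q := q) t1 (by omega)
    have b := uu_ne (p := p) (q := q) (t := t + 1) (by omega) (by omega)
    have l1 := nu_lt hnu (x := sg (uu p q t)) (fun h => (sg_ne a).1 h.1)
    have l2 := nu_lt hnu (x := uu p q (t + 1)) (fun h => b.1 h.1)
    have l3 := (hnu (sg (uu p q t))).1
    have l4 := (hnu (uu p q (t + 1))).1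
    apply up_Bd (Sc_dvd (uu_dvd hnu hc t1 t2)) <;> (try rw [hh_uu hnu hc t1 t2]) <;>
      (try simp only [ttt_e00, ttt_e10, ttt_e11]) <;> linarith
  · simp only [Sum.isLeft_inr]
    have l1 := nu_lt hnu (x := sg x) (fun h => (sg_ne ⟨hx.2.1, hx.2.2.1⟩).1 h.1)
    have l2 := nu_lt hnu (x := x) (fun h => hx.2.1 h.1)
    have l3 := (hnu (sg x)).1
    have l4 := (hnu x).1
    apply up_Bd (hh_dvd hnu hc hx.2.1 hx.2.2.1) <;> (try unfold hh) <;>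
      (try simp only [tst_e00, tst_e10, tst_e11]) <;> (try simp) <;> linarith

theorem num_setup (p q : ℕ) (hp : Nat.Prime p) (hp2 : Odd p) (hq2 : Odd q)
    (hlt : Real.sqrt p < Real.sqrt q)
    (hclose : Real.sqrt q < Real.sqrt p + Real.sqrt 2) :
    ∃ m, 1 ≤ m ∧ q = p + 2 * m ∧ (m - 1) ^ 2 < 2 * p := by
  have h1 : p < q := by
    rw [Real.sqrt_lt_sqrt_iff (by positivity)] at hlt
    exact_mod_cast hlt
  obtain ⟨a, ha⟩ := hp2
  obtain ⟨b, hb⟩ := hq2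
  obtain ⟨m', hm'⟩ : ∃ m', b = a + m' + 1 := ⟨b - a - 1, by omega⟩
  have hq : q = p + 2 * (m' + 1) := by omega
  refine ⟨m' + 1, by omega, hq, ?_⟩
  rw [Nat.add_sub_cancel]
  have hp0 : (0 : ℝ) ≤ p := by positivity
  have hq0 : (0 : ℝ) ≤ q := by positivity
  have s1 := Real.sq_sqrt hp0
  have s2 := Real.sq_sqrt hq0
  have s3 := Real.sq_sqrt (show (0 : ℝ) ≤ 2 by norm_num)
  have n1 := Real.sqrt_nonneg (p : ℝ)
  have n2 := Real.sqrt_nonneg (q : ℝ)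
  have n3 := Real.sqrt_nonneg (2 : ℝ)
  have hqr : (q : ℝ) = p + 2 * (m' + 1) := by rw [hq]; push_cast; ring
  generalize Real.sqrt (p : ℝ) = x at *
  generalize Real.sqrt (q : ℝ) = y at *
  generalize Real.sqrt (2 : ℝ) = z at *
  have h2 : (m' : ℝ) < x * z := by nlinarith
  have hm0 : (0 : ℝ) ≤ m' := by positivity
  have h3 : (m' : ℝ) ^ 2 < 2 * (p : ℝ) := by
    have h4 : (m' : ℝ) ^ 2 < (x * z) ^ 2 := pow_lt_pow_left₀ h2 hm0 two_ne_zero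
    rw [mul_pow, s1, s3] at h4
    linarith
  exact_mod_cast h3

end Fin

/-- **Theorem (Doan–Kim–Lang–Tan).** Let `p < q` be odd primes with `√p < √q < √p + √2` and
`n = pq`. Then there exist matrices `g 1, …, g ℓ` in `SL(2, ℤ)` whose lower-left entry `c i`
equals `2n` for the first `q - p` indices and `n` for the remaining ones, with
`|tr (g i)| ≤ c i - 2` and `‖g i‖_F < 2 * c i - 1`, such that the image of `Γ₀(n)` in
`PSL(2, ℤ)` is the free product of the cyclic subgroups generated by the images of the `g i`
together with the cyclic subgroup generated by (the image of) `T`. -/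
theorem stmt1 (p q : ℕ) (hp : Nat.Prime p) (hq : Nat.Prime q) (hp2 : Odd p) (hq2 : Odd q)
    (hlt : Real.sqrt p < Real.sqrt q)
    (hclose : Real.sqrt q < Real.sqrt p + Real.sqrt 2)
    (n : ℕ) (hn : n = p * q) :
    ∃ (ℓ : ℕ) (g : Fin ℓ → SL2Z) (c : Fin ℓ → ℕ),
      (∀ i : Fin ℓ, c i = if (i : ℕ) < q - p then 2 * n else n) ∧
      (∀ i, (g i : Matrix (Fin 2) (Fin 2) ℤ) 1 0 = (c i : ℤ)) ∧
      (∀ i, |(g i : Matrix (Fin 2) (Fin 2) ℤ) 0 0 + (g i : Matrix (Fin 2) (Fin 2) ℤ) 1 1|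
          ≤ (c i : ℤ) - 2) ∧
      (∀ i, Real.sqrt ((((g i : Matrix (Fin 2) (Fin 2) ℤ) 0 0 : ℝ)) ^ 2
          + (((g i : Matrix (Fin 2) (Fin 2) ℤ) 0 1 : ℝ)) ^ 2
          + (((g i : Matrix (Fin 2) (Fin 2) ℤ) 1 0 : ℝ)) ^ 2
          + (((g i : Matrix (Fin 2) (Fin 2) ℤ) 1 1 : ℝ)) ^ 2) < 2 * (c i : ℝ) - 1) ∧
      (∀ H : Option (Fin ℓ) → Subgroup PSL2Z,
        H none = Subgroup.zpowers (projPSL ModularGroup.T) →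
        (∀ i, H (some i) = Subgroup.zpowers (projPSL (g i))) →
        Function.Injective (Monoid.CoprodI.lift (fun o => (H o).subtype)) ∧
        (Monoid.CoprodI.lift (fun o => (H o).subtype)).range
          = (CongruenceSubgroup.Gamma0 n).map projPSL) := by
  classical
  have : Fact p.Prime := ⟨hp⟩
  have : Fact q.Prime := ⟨hq⟩
  obtain ⟨m, hm, hqp, hmp⟩ := num_setup p q hp hp2 hq2 hlt hclose
  obtain ⟨Al, J, hcert⟩ := cert_exists hp hq hp2 hm hqp hmp
  have hp3 : 3 ≤ p := by
    have := hp.two_le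
    obtain ⟨a, ha⟩ := hp2
    omega
  obtain ⟨B, hB⟩ := comb_exists hp3 hm hqp hcert
  have hc : Nat.Coprime p q := (Nat.coprime_primes hp hq).2 (by omega)
  obtain ⟨nu, hnu⟩ := nu_exists hc
  obtain ⟨he0, -, hep, heq⟩ := hnu (0, 1)
  have he1 := nu_lt hnu (x := ((0, 1) : ZMod p × ZMod q)) (by simp)
  simp only at hep heq
  generalize nu (0, 1) = e at he0 he1 hep heq
  have hcardJ : Fintype.card (Option J) = 2 * m := by
    rw [Fintype.card_option, Fintype.card_coe, hB.card]; omega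
  let η : Fin (2 * m + Fintype.card (RepD B nu)) ≃ Option J ⊕ RepD B nu :=
    finSumFinEquiv.symm.trans (Equiv.sumCongr (Fintype.equivFinOfCardEq hcardJ).symm
      (Fintype.equivFin (RepD B nu)).symm)
  have hη : ∀ i : Fin (2 * m + Fintype.card (RepD B nu)), (i : ℕ) < q - p ↔ (η i).isLeft = true := by
    intro i
    have : q - p = 2 * m := by omega
    rw [this]
    refine Fin.addCases (fun a => ?_) (fun b => ?_) i
    · simp [η]
    · simp [η]
  have hbd : ∀ i : Fin (2 * m + Fintype.card (RepD B nu)), 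
      Bd (GG p q J (RepD B nu) nu e (η i))
      ((if (i : ℕ) < q - p then 2 * n else n : ℕ) : ℤ) := by
    intro i
    have := GG_Bd hB hc hnu he0 he1 hep heq (η i)
    convert this using 1
    by_cases h : (i : ℕ) < q - p
    · rw [if_pos h, if_pos ((hη i).1 h), hn]; push_cast; ring
    · rw [if_neg h, if_neg (fun h' => h ((hη i).2 h')), hn]; push_cast; ring
  refine ⟨_, fun i => GG p q J (RepD B nu) nu e (η i),
    fun i => if (i : ℕ) < q - p then 2 * n else n, fun i => rfl, fun i => (hbd i).e10,
    fun i => (hbd i).tr, fun i => ?_, ?_⟩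
  · have := (hbd i).fro
    exact_mod_cast this
  · intro H h0 h1
    obtain ⟨E, hE1, hE2, hE3⟩ := coprod_aux
      (fun o : Option (Fin (2 * m + Fintype.card (RepD B nu))) => o.elim (projPSL ModularGroup.T)
        (fun i => projPSL (GG p q J (RepD B nu) nu e (η i)))) H (by
        rintro (_ | i)
        · exact h0
        · exact h1 i)
    have hE1' : ∀ s, Monoid.CoprodI.lift (fun o => (H o).subtype) (E (some (η.symm s))) =
        projPSL (GG p q J (RepD B nu) nu e s) := by
      intro s
      rw [hE1]; simp
    have key := main_abs hB hc hnu he0 he1 hep heq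
      (Monoid.CoprodI.lift (fun o => (H o).subtype))
      (fun x => if hx : x ∈ RepD B nu then E (some (η.symm (Sum.inr ⟨x, hx⟩))) else 1)
      (fun t => if ht : t ∈ J then E (some (η.symm (Sum.inl (some ⟨t, ht⟩)))) else 1)
      (E (some (η.symm (Sum.inl none)))) (E none)
      (by
        intro x hx
        simp only [dif_pos hx]
        rw [hE1']; rfl)
      (by
        intro t ht
        simp only [dif_pos ht]
        rw [hE1']; rfl)
      (by rw [hE1']; rfl) (by rw [hE1]; rfl)
      (by
        intro K k1 k2 k3 k4
        apply hE2 K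
        rintro (_ | i)
        · exact k4
        · obtain ⟨s, rfl⟩ := η.symm.surjective i
          rcases s with (_ | ⟨t, ht⟩) | ⟨x, hx⟩
          · exact k3
          · have := k2 t ht
            rwa [dif_pos ht] at this
          · have := k1 x hx
            rwa [dif_pos hx] at this)
      (by
        intro x hx k
        simp only [dif_pos hx]
        rw [hE1]
        exact hE3 _ k)
    refine ⟨key.1, ?_⟩
    ext x
    obtain ⟨A, rfl⟩ := proj_surj x
    rw [key.2 A, Subgroup.mem_map]
    have hG : ∀ A : SL2Z, A ∈ CongruenceSubgroup.Gamma0 n ↔ (p : ℤ) * q ∣ A 1 0 := by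
      intro A
      rw [CongruenceSubgroup.Gamma0_mem, ZMod.intCast_zmod_eq_zero_iff_dvd, hn]
      push_cast; rfl
    constructor
    · intro h
      exact ⟨A, (hG A).2 h, rfl⟩
    · rintro ⟨A', h1, h2⟩
      rw [hG] at h1
      rcases (proj_eq_iff _ _).1 h2 with rfl | rfl
      · exact h1
      · rw [neg_e, dvd_neg]; exact h1
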